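/- arXiv:1911.08513 — 4 statements merged into one kernel-verified Lean document; each statement's English description precedes it below -/
import Mathlib

section
/- Suppose K_n → ∞, K_n²/P_n → 0, and the sequence (n·p_{e,q}(n) − ln n)/ln ln n is bounded. Fix constant integers m ≥ 1 and h ≥ 0. Then the probability of the event that the vertices v_1, …, v_m all have degree exactly h in 𝔾_q(n,K_n,P_n,p_n), no two vertices among v_1, …, v_m are adjacent to each other, and no vertex outside {v_1,…,v_m} is adjacent to two or more of v_1,…,v_m, is asymptotically equivalent, as n → ∞, to (h!)^{−m}·(n·p_{e,q}(n))^{hm}·e^{−m·n·p_{e,q}(n)}, i.e., the ratio of the two quantities tends to 1. -/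
open Finset Filter

/-- A configuration of the random graph `𝔾_q(n,K,P,p)`: a key-ring assignment
(one finite subset of the key pool `Fin P` per vertex) together with the
on/off states of the channels (one Boolean per unordered pair of vertices). -/
abbrev Config (n P : ℕ) : Type := (Fin n → Finset (Fin P)) × (Sym2 (Fin n) → Bool)

/-- Probability weight of a configuration: the key rings are independent and
uniform over the `K`-element subsets of the pool of size `P`, and the channels
are independent Bernoulli(`p`). -/
noncomputable def weight (n K P : ℕ) (p : ℝ) (ω : Config n P) : ℝ :=
  (∏ i : Fin n, if (ω.1 i).card = K then ((P.choose K : ℝ))⁻¹ else 0) *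
  (∏ e : Sym2 (Fin n), if ω.2 e then p else 1 - p)

/-- Probability of an event in `𝔾_q(n,K,P,p)`. -/
noncomputable def prob (n K P : ℕ) (p : ℝ) (E : Set (Config n P)) : ℝ :=
  ∑ ω : Config n P, Set.indicator E (weight n K P p) ω

/-- Adjacency in `𝔾_q(n,K,P,p)`: two distinct vertices are adjacent iff their
key rings share at least `q` keys and the channel between them is on. -/
def Adj (q n P : ℕ) (ω : Config n P) (i j : Fin n) : Prop :=
  i ≠ j ∧ q ≤ ((ω.1 i) ∩ (ω.1 j)).card ∧ ω.2 s(i, j) = true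

/-- Degree of a vertex. -/
noncomputable def degree (q n P : ℕ) (ω : Config n P) (i : Fin n) : ℕ :=
  Nat.card {j : Fin n // Adj q n P ω i j}

/-- Minimum degree of the graph. -/
noncomputable def minDeg (q n P : ℕ) (ω : Config n P) : ℕ :=
  sInf (Set.range fun i => degree q n P ω i)

/-- `p_{s,q}`: the probability that two key rings share at least `q` keys. -/
noncomputable def psq (q K P : ℕ) : ℝ :=
  1 - ∑ u ∈ Finset.range q,
    ((K.choose u : ℝ) * ((P - K).choose (K - u) : ℝ)) / (P.choose K : ℝ)

/-- `p_{e,q}`: the probability that two distinct vertices are adjacent. -/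
noncomputable def peq (q K P : ℕ) (p : ℝ) : ℝ := p * psq q K P

/-- The probability that a uniform `K`-subset of a pool of size `P` equals `A`. -/
noncomputable def ringWeight (K P : ℕ) (A : Finset (Fin P)) : ℝ :=
  if A.card = K then ((P.choose K : ℝ))⁻¹ else 0

/-- Expectation of `f` over a uniform `K`-subset of a pool of size `P`. -/
noncomputable def ringExp (K P : ℕ) (f : Finset (Fin P) → ℝ) : ℝ :=
  ∑ A, ringWeight K P A * f A

/-- Indicator that two key rings share at least `q` keys. -/
noncomputable def shareInd (q : ℕ) {P : ℕ} (A B : Finset (Fin P)) : ℝ :=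
  if q ≤ (A ∩ B).card then 1 else 0

lemma shareInd_nonneg (q : ℕ) {P : ℕ} (A B : Finset (Fin P)) : 0 ≤ shareInd q A B := by
  unfold shareInd; split_ifs <;> norm_num

lemma shareInd_le_one (q : ℕ) {P : ℕ} (A B : Finset (Fin P)) : shareInd q A B ≤ 1 := by
  unfold shareInd; split_ifs <;> norm_num

lemma ringWeight_nonneg (K P : ℕ) (A : Finset (Fin P)) : 0 ≤ ringWeight K P A := by
  unfold ringWeight; split_ifs <;> positivity

lemma ringExp_mono {K P : ℕ} {f g : Finset (Fin P) → ℝ}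
    (h : ∀ A, A.card = K → f A ≤ g A) : ringExp K P f ≤ ringExp K P g := by
  refine Finset.sum_le_sum fun A _ => ?_
  by_cases hA : A.card = K
  · exact mul_le_mul_of_nonneg_left (h A hA) (ringWeight_nonneg _ _ _)
  · simp [ringWeight, hA]

lemma ringExp_add (K P : ℕ) (f g : Finset (Fin P) → ℝ) :
    ringExp K P (fun A => f A + g A) = ringExp K P f + ringExp K P g := by
  simp [ringExp, mul_add, Finset.sum_add_distrib]

lemma ringExp_sub (K P : ℕ) (f g : Finset (Fin P) → ℝ) :
    ringExp K P (fun A => f A - g A) = ringExp K P f - ringExp K P g := by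
  simp [ringExp, mul_sub, Finset.sum_sub_distrib]

lemma ringExp_const_mul (K P : ℕ) (c : ℝ) (f : Finset (Fin P) → ℝ) :
    ringExp K P (fun A => c * f A) = c * ringExp K P f := by
  simp only [ringExp, Finset.mul_sum]
  exact Finset.sum_congr rfl fun A _ => by ring

lemma ringExp_sum {ι : Type*} (K P : ℕ) (s : Finset ι) (f : ι → Finset (Fin P) → ℝ) :
    ringExp K P (fun A => ∑ i ∈ s, f i A) = ∑ i ∈ s, ringExp K P (f i) := by
  simp only [ringExp, Finset.mul_sum]
  exact Finset.sum_comm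

lemma ringExp_ite (K P : ℕ) (s : Finset (Fin P) → Prop) [DecidablePred s] :
    ringExp K P (fun A => if s A then 1 else 0) =
      (((univ.powersetCard K).filter s).card : ℝ) / (P.choose K : ℝ) := by
  have : ((univ : Finset (Finset (Fin P))).filter fun A => A.card = K) =
      univ.powersetCard K := by
    ext A; simp [Finset.mem_powersetCard]
  simp only [ringExp, ringWeight, mul_ite, mul_one, mul_zero, ← ite_and]
  rw [← Finset.sum_filter, Finset.sum_const, ← this, Finset.filter_filter, nsmul_eq_mul,
    div_eq_mul_inv]
  simp only [and_comm]

lemma ringExp_one {K P : ℕ} (hKP : K ≤ P) : ringExp K P (fun _ => 1) = 1 := by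
  have := ringExp_ite K P (fun _ => True)
  simp only [if_true, Finset.filter_true, Finset.card_powersetCard, Finset.card_univ,
    Fintype.card_fin] at this
  rw [this, div_self]
  exact_mod_cast (Nat.choose_pos hKP).ne'

lemma ringExp_nonneg {K P : ℕ} {f : Finset (Fin P) → ℝ} (h : ∀ A, 0 ≤ f A) :
    0 ≤ ringExp K P f :=
  Finset.sum_nonneg fun A _ => mul_nonneg (ringWeight_nonneg _ _ _) (h A)

lemma descFactorial_mul_pow_le {K P : ℕ} (hKP : K ≤ P) (u : ℕ) :
    K.descFactorial u * P ^ u ≤ P.descFactorial u * K ^ u := by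
  induction u with
  | zero => simp
  | succ u ih =>
    have h : (K - u) * P ≤ (P - u) * K := by
      rw [Nat.sub_mul, Nat.sub_mul, mul_comm K P]
      exact Nat.sub_le_sub_left (Nat.mul_le_mul_left u hKP) _
    calc K.descFactorial (u + 1) * P ^ (u + 1)
        = ((K - u) * P) * (K.descFactorial u * P ^ u) := by
          rw [Nat.descFactorial_succ]; ring
      _ ≤ ((P - u) * K) * (P.descFactorial u * K ^ u) := Nat.mul_le_mul h ih
      _ = _ := by rw [Nat.descFactorial_succ]; ring

lemma choose_mul_pow_le {K P : ℕ} (hKP : K ≤ P) (u : ℕ) :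
    K.choose u * P ^ u ≤ P.choose u * K ^ u := by
  have h := descFactorial_mul_pow_le hKP u
  rw [Nat.descFactorial_eq_factorial_mul_choose, Nat.descFactorial_eq_factorial_mul_choose,
    mul_assoc, mul_assoc] at h
  exact Nat.le_of_mul_le_mul_left h (Nat.factorial_pos u)

lemma ringExp_superset_le {K P : ℕ} (hK : 1 ≤ K) (hKP : K ≤ P) (U : Finset (Fin P)) :
    ringExp K P (fun A => if U ⊆ A then 1 else 0) ≤ ((K : ℝ) / P) ^ U.card := by
  rw [ringExp_ite]
  have hP : 0 < P := by omega
  by_cases hU : U.card ≤ K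
  · rw [Finset.card_filter_powersetCard_subset _ _ _ (Finset.subset_univ U) hU]
    have hc : (0 : ℝ) < P.choose K := by exact_mod_cast Nat.choose_pos hKP
    rw [div_pow, div_le_div_iff₀ hc (by positivity)]
    have h1 := Nat.choose_mul (n := P) hU
    have h2 := choose_mul_pow_le hKP U.card
    have h3 : 0 < P.choose U.card := Nat.choose_pos (hU.trans hKP)
    simp only [Finset.card_univ, Fintype.card_fin]
    norm_cast
    refine Nat.le_of_mul_le_mul_left ?_ h3
    calc P.choose U.card * ((P - U.card).choose (K - U.card) * P ^ U.card)
        = P.choose K * (K.choose U.card * P ^ U.card) := by rw [← mul_assoc, ← h1]; ring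
      _ ≤ P.choose K * (P.choose U.card * K ^ U.card) := Nat.mul_le_mul_left _ h2
      _ = _ := by ring
  · have : ((univ : Finset (Fin P)).powersetCard K).filter (U ⊆ ·) = ∅ := by
      refine Finset.filter_eq_empty_iff.2 fun A hA hUA => hU ?_
      rw [← (Finset.mem_powersetCard.1 hA).2]
      exact Finset.card_le_card hUA
    rw [this]
    simp only [Finset.card_empty, Nat.cast_zero, zero_div]
    positivity

lemma card_filter_inter_card {K P : ℕ} (A : Finset (Fin P)) (hA : A.card = K) {u : ℕ}
    (hu : u ≤ K) :
    ((univ.powersetCard K).filter fun B => (B ∩ A).card = u).card =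
      K.choose u * (P - K).choose (K - u) := by
  have h : (A.powersetCard u ×ˢ Aᶜ.powersetCard (K - u)).card =
      K.choose u * (P - K).choose (K - u) := by
    rw [Finset.card_product, Finset.card_powersetCard, Finset.card_powersetCard,
      Finset.card_compl, hA, Fintype.card_fin]
  rw [← h]
  refine Finset.card_nbij' (fun B => (B ∩ A, B \ A)) (fun x => x.1 ∪ x.2) ?_ ?_ ?_ ?_
  · intro B hB
    simp only [Finset.coe_filter, Finset.mem_powersetCard, Set.mem_ofPred_eq] at hB
    simp only [Finset.coe_product, Set.mem_prod, Finset.mem_coe, Finset.mem_powersetCard]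
    have := Finset.card_inter_add_card_sdiff B A
    refine ⟨⟨Finset.inter_subset_right, hB.2⟩, ?_, by omega⟩
    intro x hx
    simpa using (Finset.mem_sdiff.1 hx).2
  · rintro ⟨X, Y⟩ hXY
    simp only [Finset.coe_product, Set.mem_prod, Finset.mem_coe, Finset.mem_powersetCard] at hXY
    obtain ⟨⟨hX, hXc⟩, hY, hYc⟩ := hXY
    have hd : Disjoint X Y :=
      Finset.disjoint_of_subset_left hX
        (Finset.disjoint_of_subset_right hY disjoint_compl_right)
    have hYA : Y ∩ A = ∅ :=
      Finset.disjoint_iff_inter_eq_empty.1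
        (Finset.disjoint_of_subset_left hY disjoint_compl_left)
    simp only [Finset.coe_filter, Finset.mem_powersetCard, Set.mem_ofPred_eq]
    refine ⟨⟨Finset.subset_univ _, by rw [Finset.card_union_of_disjoint hd]; omega⟩, ?_⟩
    rw [Finset.union_inter_distrib_right, hYA, Finset.union_empty,
      Finset.inter_eq_left.2 hX, hXc]
  · intro B _
    ext x; simp only [Finset.mem_union, Finset.mem_inter, Finset.mem_sdiff]; tauto
  · rintro ⟨X, Y⟩ hXY
    simp only [Finset.coe_product, Set.mem_prod, Finset.mem_coe, Finset.mem_powersetCard] at hXY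
    obtain ⟨⟨hX, -⟩, hY, -⟩ := hXY
    ext x
    · have h1 := @hX x
      have h2 := @hY x
      simp only [Finset.mem_compl] at h2
      simp only [Finset.mem_inter, Finset.mem_union]
      tauto
    · have h1 := @hX x
      have h2 := @hY x
      simp only [Finset.mem_compl] at h2
      simp only [Finset.mem_sdiff, Finset.mem_union]
      tauto

lemma ringExp_shareInd {q K P : ℕ} (hKP : K ≤ P) {A : Finset (Fin P)} (hA : A.card = K) :
    ringExp K P (fun B => shareInd q B A) = psq q K P := by
  have h1 : (fun B : Finset (Fin P) => shareInd q B A) =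
      fun B => 1 - ∑ u ∈ Finset.range q, if (B ∩ A).card = u then (1 : ℝ) else 0 := by
    funext B
    rw [Finset.sum_ite_eq]
    unfold shareInd
    simp only [Finset.mem_range]
    by_cases h : q ≤ (B ∩ A).card
    · simp [h, not_lt.2 h]
    · simp [h, not_le.1 h]
  rw [h1, ringExp_sub, ringExp_one hKP, ringExp_sum, psq]
  congr 1
  refine Finset.sum_congr rfl fun u _ => ?_
  rw [ringExp_ite]
  by_cases hu : u ≤ K
  · rw [card_filter_inter_card A hA hu, Nat.cast_mul]
  · rw [Nat.choose_eq_zero_of_lt (not_le.1 hu)]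
    have : ((univ : Finset (Fin P)).powersetCard K).filter (fun B => (B ∩ A).card = u) = ∅ := by
      refine Finset.filter_eq_empty_iff.2 fun B _ hB => hu ?_
      rw [← hB, ← hA]
      exact Finset.card_le_card Finset.inter_subset_right
    simp [this]

/-- The expected number of `q`-subsets of a fixed key ring contained in a random one is at most
this quantity. -/
noncomputable def overlapBound (q K P : ℕ) : ℝ := (K.choose q : ℝ) * ((K : ℝ) / P) ^ q

lemma overlapBound_nonneg (q K P : ℕ) : 0 ≤ overlapBound q K P := by
  unfold overlapBound; positivity

lemma exists_ring {K P : ℕ} (hKP : K ≤ P) : ∃ A : Finset (Fin P), A.card = K := by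
  obtain ⟨A, -, hA⟩ := Finset.exists_subset_card_eq (s := (univ : Finset (Fin P))) (n := K)
    (by simpa using hKP)
  exact ⟨A, hA⟩

lemma psq_nonneg {q K P : ℕ} (hKP : K ≤ P) : 0 ≤ psq q K P := by
  obtain ⟨A, hA⟩ := exists_ring hKP
  rw [← ringExp_shareInd hKP hA]
  exact ringExp_nonneg fun B => shareInd_nonneg _ _ _

lemma overlapBound_le_psq {q K P : ℕ} (hqK : 2 * q ≤ K) (hK : 1 ≤ K) (hKP : 4 * K ^ 2 ≤ P) :
    overlapBound q K P ≤ 2 ^ (q + 1) * psq q K P := by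
  have hKP' : K ≤ P := by nlinarith
  have hKP2 : 2 * K ≤ P := by nlinarith
  obtain ⟨A, hA⟩ := exists_ring hKP'
  have hlow : (K.choose q : ℝ) * ((P - K).choose (K - q) : ℝ) / (P.choose K : ℝ) ≤ psq q K P := by
    rw [← ringExp_shareInd hKP' hA, ← Nat.cast_mul, ← card_filter_inter_card A hA (by omega),
      ← ringExp_ite]
    refine ringExp_mono fun B _ => ?_
    unfold shareInd
    split_ifs <;> first | omega | norm_num
  have hP : (0 : ℝ) < P := by exact_mod_cast (show 0 < P by omega)
  have hc : (0 : ℝ) < P.choose K := by exact_mod_cast Nat.choose_pos hKP'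
  have hKP4 : 4 * (K : ℝ) ^ 2 ≤ P := by exact_mod_cast hKP
  have hK0 : (1 : ℝ) ≤ K := by exact_mod_cast hK
  have hqK' : 2 * (q : ℝ) ≤ K := by exact_mod_cast hqK
  have h1 : ((P : ℝ) - 2 * K) ^ (K - q) / (K - q).factorial ≤ (P - K).choose (K - q) := by
    refine le_trans ?_ (Nat.pow_le_choose (α := ℝ) (K - q) (P - K))
    gcongr
    · nlinarith
    · rw [Nat.cast_sub (by omega), Nat.cast_add, Nat.cast_sub (by omega), Nat.cast_sub (by omega)]
      push_cast
      linarith [Nat.cast_nonneg (α := ℝ) q]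
  have h2 : (P.choose K : ℝ) ≤ (P : ℝ) ^ K / K.factorial := Nat.choose_le_pow_div K P
  have h3 : ((K : ℝ) / 2) ^ q * (K - q).factorial ≤ K.factorial := by
    have h := Nat.factorial_mul_descFactorial (show q ≤ K by omega)
    rw [← h, mul_comm]
    push_cast
    gcongr
    calc ((K : ℝ) / 2) ^ q ≤ ((K + 1 - q : ℕ) : ℝ) ^ q := by
          gcongr
          rw [Nat.cast_sub (by omega)]
          push_cast
          linarith
      _ ≤ K.descFactorial q := by exact_mod_cast Nat.pow_sub_le_descFactorial K q
  have h4 : (1 : ℝ) / 2 * P ^ (K - q) ≤ ((P : ℝ) - 2 * K) ^ (K - q) := by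
    have hb := one_add_mul_le_pow (a := -(2 * (K : ℝ) / P)) (by
      have : 2 * (K : ℝ) / P ≤ 1 := by rw [div_le_one hP]; nlinarith
      linarith) (K - q)
    have he : ((P : ℝ) - 2 * K) ^ (K - q) = P ^ (K - q) * (1 + -(2 * (K : ℝ) / P)) ^ (K - q) := by
      rw [← mul_pow]; congr 1; field_simp; ring
    rw [he, mul_comm]
    gcongr
    refine le_trans ?_ hb
    have : ((K - q : ℕ) : ℝ) * (2 * (K : ℝ) / P) ≤ 1 / 2 := by
      rw [← mul_div_assoc, div_le_iff₀ hP]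
      have : ((K - q : ℕ) : ℝ) ≤ K := by exact_mod_cast Nat.sub_le K q
      nlinarith
    linarith
  have h5 : ((K : ℝ) / P) ^ q ≤
      2 ^ (q + 1) * (((P - K).choose (K - q) : ℝ) / (P.choose K : ℝ)) := by
    rw [← mul_div_assoc, le_div_iff₀ hc]
    have hf : (0 : ℝ) < (K - q).factorial := by exact_mod_cast Nat.factorial_pos _
    have hfK : (0 : ℝ) < K.factorial := by exact_mod_cast Nat.factorial_pos _
    have hPK : (P : ℝ) ^ K = P ^ q * P ^ (K - q) := by rw [← pow_add]; congr 1; omega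
    calc ((K : ℝ) / P) ^ q * (P.choose K : ℝ)
        ≤ ((K : ℝ) / P) ^ q * ((P : ℝ) ^ K / K.factorial) := by gcongr
      _ = (K : ℝ) ^ q * P ^ (K - q) / K.factorial := by
          rw [div_pow, hPK]; field_simp
      _ ≤ (2 ^ q * P ^ (K - q)) / (K - q).factorial := by
          rw [div_le_div_iff₀ hfK hf]
          rw [div_pow] at h3
          have h3' : (K : ℝ) ^ q * (K - q).factorial ≤ 2 ^ q * K.factorial := by
            rw [div_mul_eq_mul_div, div_le_iff₀ (by positivity)] at h3
            linarith
          nlinarith [mul_le_mul_of_nonneg_right h3' (pow_nonneg hP.le (K - q))]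
      _ = 2 ^ (q + 1) * ((1 / 2 * P ^ (K - q)) / (K - q).factorial) := by ring
      _ ≤ 2 ^ (q + 1) * (((P : ℝ) - 2 * K) ^ (K - q) / (K - q).factorial) := by gcongr
      _ ≤ _ := by gcongr
  calc overlapBound q K P
      ≤ (K.choose q : ℝ) *
        (2 ^ (q + 1) * (((P - K).choose (K - q) : ℝ) / (P.choose K : ℝ))) := by
        unfold overlapBound; gcongr
    _ = 2 ^ (q + 1) * ((K.choose q : ℝ) * ((P - K).choose (K - q) : ℝ) / (P.choose K : ℝ)) := by
        ring
    _ ≤ _ := by gcongr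

lemma pow_le_overlapBound {q K P : ℕ} (hqK : 2 * q ≤ K) :
    ((K : ℝ) ^ 2 / P) ^ q ≤ 2 ^ q * q.factorial * overlapBound q K P := by
  have hqK' : 2 * (q : ℝ) ≤ K := by exact_mod_cast hqK
  have h1 : ((K : ℝ) / 2) ^ q ≤ q.factorial * K.choose q := by
    have h := Nat.pow_le_choose (α := ℝ) q K
    rw [div_le_iff₀ (by positivity), mul_comm] at h
    refine le_trans ?_ h
    gcongr
    rw [Nat.cast_sub (by omega)]
    push_cast
    linarith
  calc ((K : ℝ) ^ 2 / P) ^ q = 2 ^ q * ((K : ℝ) / 2) ^ q * ((K : ℝ) / P) ^ q := by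
        rw [← mul_pow, ← mul_pow]; congr 1; ring
    _ ≤ 2 ^ q * (q.factorial * K.choose q) * ((K : ℝ) / P) ^ q := by gcongr
    _ = _ := by unfold overlapBound; ring

lemma ringExp_shareInd_mul_le {q K P : ℕ} (hq : 1 ≤ q) (hK : 1 ≤ K) (hKP : K ≤ P)
    {A B : Finset (Fin P)} (hA : A.card = K) (hB : B.card = K) :
    ringExp K P (fun C => shareInd q C A * shareInd q C B) ≤
      (A ∩ B).card * (q / K * overlapBound q K P) + overlapBound q K P ^ 2 := by
  have hpt : ∀ C : Finset (Fin P), shareInd q C A * shareInd q C B ≤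
      (∑ x ∈ A ∩ B, ∑ Q ∈ (A.powersetCard q).filter ({x} ⊆ ·), if Q ⊆ C then (1 : ℝ) else 0) +
      ∑ y ∈ (A.powersetCard q ×ˢ B.powersetCard q).filter (fun y => Disjoint y.1 y.2),
        if y.1 ∪ y.2 ⊆ C then (1 : ℝ) else 0 := by
    intro C
    have n1 : 0 ≤ ∑ x ∈ A ∩ B, ∑ Q ∈ (A.powersetCard q).filter ({x} ⊆ ·),
        if Q ⊆ C then (1 : ℝ) else 0 := by positivity
    have n2 : 0 ≤ ∑ y ∈ (A.powersetCard q ×ˢ B.powersetCard q).filter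
        (fun y => Disjoint y.1 y.2), if y.1 ∪ y.2 ⊆ C then (1 : ℝ) else 0 := by positivity
    by_cases h : q ≤ (C ∩ A).card ∧ q ≤ (C ∩ B).card
    · refine (mul_le_one₀ (shareInd_le_one _ _ _) (shareInd_nonneg _ _ _)
        (shareInd_le_one _ _ _)).trans ?_
      obtain ⟨Q, hQ, hQc⟩ := Finset.exists_subset_card_eq h.1
      obtain ⟨Q', hQ', hQc'⟩ := Finset.exists_subset_card_eq h.2
      rw [Finset.subset_inter_iff] at hQ hQ'
      by_cases hd : Disjoint Q Q'
      · refine le_add_of_nonneg_of_le n1 ?_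
        have := Finset.single_le_sum (s := (A.powersetCard q ×ˢ B.powersetCard q).filter
          (fun y => Disjoint y.1 y.2)) (f := fun y => if y.1 ∪ y.2 ⊆ C then (1 : ℝ) else 0)
          (fun y _ => by positivity) (a := (Q, Q'))
          (by simp [Finset.mem_powersetCard, hQ.2, hQ'.2, hQc, hQc', hd])
        simpa [Finset.union_subset hQ.1 hQ'.1] using this
      · refine le_add_of_le_of_nonneg ?_ n2
        obtain ⟨x, hx, hx'⟩ := Finset.not_disjoint_iff.1 hd
        have h1 := Finset.single_le_sum (s := (A.powersetCard q).filter ({x} ⊆ ·))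
          (f := fun Q => if Q ⊆ C then (1 : ℝ) else 0) (fun y _ => by positivity) (a := Q)
          (by simp [Finset.mem_powersetCard, hQ.2, hQc, hx])
        have h2 := Finset.single_le_sum (s := A ∩ B)
          (f := fun x => ∑ Q ∈ (A.powersetCard q).filter ({x} ⊆ ·),
            if Q ⊆ C then (1 : ℝ) else 0) (fun y _ => by positivity) (a := x)
          (by simp [hQ.2 hx, hQ'.2 hx'])
        simp only [hQ.1, if_true] at h1
        exact h1.trans h2
    · have : shareInd q C A * shareInd q C B = 0 := by
        unfold shareInd
        rw [mul_eq_zero]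
        by_contra hne
        push Not at hne
        exact h ⟨by by_contra h'; simp [h'] at hne, by by_contra h'; simp [h'] at hne⟩
      rw [this]
      exact add_nonneg n1 n2
  refine (ringExp_mono fun C _ => hpt C).trans ?_
  rw [ringExp_add, ringExp_sum, ringExp_sum]
  refine add_le_add ?_ ?_
  · rw [← nsmul_eq_mul, ← Finset.sum_const]
    refine Finset.sum_le_sum fun x hx => ?_
    rw [ringExp_sum]
    have hcard : (((A.powersetCard q).filter ({x} ⊆ ·)).card : ℝ) = q / K * K.choose q := by
      rw [Finset.card_filter_powersetCard_subset _ _ _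
        (by simpa using (Finset.mem_inter.1 hx).1) (by simpa using hq)]
      rw [Finset.card_singleton, hA, div_mul_eq_mul_div, eq_div_iff (by positivity)]
      obtain ⟨K, rfl⟩ : ∃ k, K = k + 1 := ⟨K - 1, by omega⟩
      obtain ⟨q, rfl⟩ : ∃ k, q = k + 1 := ⟨q - 1, by omega⟩
      have := Nat.add_one_mul_choose_eq K q
      simp only [Nat.add_sub_cancel]
      norm_cast
      linarith
    calc _ ≤ ∑ Q ∈ (A.powersetCard q).filter ({x} ⊆ ·), ((K : ℝ) / P) ^ q := by
          refine Finset.sum_le_sum fun Q hQ => ?_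
          rw [← (Finset.mem_powersetCard.1 (Finset.mem_filter.1 hQ).1).2]
          exact ringExp_superset_le hK hKP Q
      _ = _ := by
        rw [Finset.sum_const, nsmul_eq_mul, hcard, overlapBound]; ring
  · calc _ ≤ ∑ y ∈ (A.powersetCard q ×ˢ B.powersetCard q).filter (fun y => Disjoint y.1 y.2),
          ((K : ℝ) / P) ^ (q + q) := by
          refine Finset.sum_le_sum fun y hy => ?_
          simp only [Finset.mem_filter, Finset.mem_product, Finset.mem_powersetCard] at hy
          obtain ⟨⟨⟨-, h1⟩, -, h2⟩, hd⟩ := hy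
          refine (ringExp_superset_le hK hKP (y.1 ∪ y.2)).trans ?_
          rw [Finset.card_union_of_disjoint hd, h1, h2]
      _ ≤ ∑ y ∈ A.powersetCard q ×ˢ B.powersetCard q, ((K : ℝ) / P) ^ (q + q) :=
          Finset.sum_le_sum_of_subset_of_nonneg (Finset.filter_subset _ _)
            fun _ _ _ => by positivity
      _ = _ := by
          rw [Finset.sum_const, Finset.card_product, Finset.card_powersetCard,
            Finset.card_powersetCard, hA, hB, nsmul_eq_mul, overlapBound]
          push_cast
          ring

/-- The first `m` vertices. -/
abbrev Core (n m : ℕ) : Type := {i : Fin n // (i : ℕ) < m}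

/-- The vertices other than the first `m`. -/
abbrev Outer (n m : ℕ) : Type := {i : Fin n // ¬ (i : ℕ) < m}

/-- Assignments of disjoint `h`-element sets of outer vertices to the core vertices. -/
noncomputable def patterns (n m h : ℕ) : Finset (Core n m → Finset (Outer n m)) :=
  univ.filter fun D => (∀ i, (D i).card = h) ∧ ∀ i j, i ≠ j → Disjoint (D i) (D j)

/-- The channel state `b` of the pair `e` is consistent with the core vertices having outer
neighbours `D`. -/
def CrossOK (q : ℕ) {n m P : ℕ} (D : Core n m → Finset (Outer n m))
    (S : Fin n → Finset (Fin P)) (e : Sym2 (Fin n)) (b : Bool) : Prop :=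
  ∀ (w : Outer n m) (i : Core n m), e = s(w.1, i.1) →
    ((q ≤ (S w ∩ S i).card ∧ b = true) ↔ w ∈ D i)

/-- The channel state `b` of the pair `e` does not join two core vertices. -/
def CoreOK (q : ℕ) {n m P : ℕ} (S : Core n m → Finset (Fin P)) (e : Sym2 (Fin n)) (b : Bool) :
    Prop :=
  ∀ i j : Core n m, i ≠ j → e = s(i.1, j.1) → ¬ (q ≤ (S i ∩ S j).card ∧ b = true)

/-- The core vertices all have degree `h`, no two of them are adjacent, and no outer vertex is
adjacent to two of them. -/
def isolatedDegreeEvent (q n P m h : ℕ) : Set (Config n P) :=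
  {ω | (∀ i : Fin n, (i : ℕ) < m → degree q n P ω i = h) ∧
    (∀ i j : Fin n, (i : ℕ) < m → (j : ℕ) < m → ¬ Adj q n P ω i j) ∧
    (∀ w i j : Fin n, m ≤ (w : ℕ) → (i : ℕ) < m → (j : ℕ) < m → i ≠ j →
      ¬ (Adj q n P ω w i ∧ Adj q n P ω w j))}

open Classical in
/-- The set of outer neighbours of a core vertex. -/
noncomputable def outerNbrs (q : ℕ) {n m P : ℕ} (ω : Config n P) (i : Core n m) :
    Finset (Outer n m) :=
  univ.filter fun w => Adj q n P ω w i

lemma mem_outerNbrs {q n m P : ℕ} {ω : Config n P} {i : Core n m} {w : Outer n m} :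
    w ∈ outerNbrs q ω i ↔ Adj q n P ω w i := by
  simp [outerNbrs]

lemma Outer.ne {n m : ℕ} (w : Outer n m) (i : Core n m) : w.1 ≠ i.1 := fun h =>
  w.2 (h ▸ i.2)

lemma Adj.symm' {q n P : ℕ} {ω : Config n P} {i j : Fin n} (h : Adj q n P ω i j) :
    Adj q n P ω j i :=
  ⟨h.1.symm, by rw [Finset.inter_comm]; exact h.2.1, by rw [Sym2.eq_swap]; exact h.2.2⟩

lemma crossOK_iff {q n m P : ℕ} {ω : Config n P} {D : Core n m → Finset (Outer n m)} :
    (∀ e, CrossOK q D ω.1 e (ω.2 e)) ↔ D = outerNbrs q ω := by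
  constructor
  · intro h
    funext i
    ext w
    rw [mem_outerNbrs, ← h _ w i rfl]
    exact ⟨fun h => ⟨w.ne i, h⟩, fun h => h.2⟩
  · rintro rfl e w i rfl
    rw [mem_outerNbrs]
    exact ⟨fun h => ⟨w.ne i, h⟩, fun h => h.2⟩

lemma coreOK_iff {q n m P : ℕ} {ω : Config n P} :
    (∀ e, CoreOK (m := m) q (fun i => ω.1 i) e (ω.2 e)) ↔
      ∀ i j : Fin n, (i : ℕ) < m → (j : ℕ) < m → ¬ Adj q n P ω i j := by
  constructor
  · intro h i j hi hj hij
    exact h _ ⟨i, hi⟩ ⟨j, hj⟩ (fun h => hij.1 (congrArg Subtype.val h)) rfl hij.2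
  · rintro h e i j hij rfl hb
    exact h i j i.2 j.2 ⟨fun h => hij (Subtype.ext h), hb⟩

lemma degree_eq_card_outerNbrs {q n m P : ℕ} {ω : Config n P}
    (h : ∀ i j : Fin n, (i : ℕ) < m → (j : ℕ) < m → ¬ Adj q n P ω i j) (i : Core n m) :
    degree q n P ω i = (outerNbrs q ω i).card := by
  rw [degree, ← Nat.card_eq_finsetCard]
  refine Nat.card_congr
    ⟨fun j => ⟨⟨j.1, fun hj => h _ _ i.2 hj j.2⟩, mem_outerNbrs.2 j.2.symm'⟩,
      fun w => ⟨w.1.1, (mem_outerNbrs.1 w.2).symm'⟩, fun _ => rfl, fun _ => rfl⟩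

lemma mem_isolatedDegreeEvent_iff {q n m P h : ℕ} {ω : Config n P} :
    ω ∈ isolatedDegreeEvent q n P m h ↔ outerNbrs q ω ∈ patterns n m h ∧
      ∀ e, CoreOK (m := m) q (fun i => ω.1 i) e (ω.2 e) := by
  rw [coreOK_iff, patterns, Finset.mem_filter]
  constructor
  · rintro ⟨h1, h2, h3⟩
    refine ⟨⟨Finset.mem_univ _, fun i => ?_, fun i j hij => ?_⟩, h2⟩
    · rw [← degree_eq_card_outerNbrs h2, h1 i i.2]
    · refine Finset.disjoint_left.2 fun w hi hj => ?_
      exact h3 w i j (not_lt.1 w.2) i.2 j.2 (fun h => hij (Subtype.ext h))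
        ⟨mem_outerNbrs.1 hi, mem_outerNbrs.1 hj⟩
  · rintro ⟨⟨-, h1, h3⟩, h2⟩
    refine ⟨fun i hi => ?_, h2, fun w i j hw hi hj hij hadj => ?_⟩
    · rw [← h1 ⟨i, hi⟩, ← degree_eq_card_outerNbrs h2]
    · exact Finset.disjoint_left.1
        (h3 ⟨i, hi⟩ ⟨j, hj⟩ fun h => hij (congrArg Subtype.val h))
        (mem_outerNbrs (w := ⟨w, not_lt.2 hw⟩).2 hadj.1) (mem_outerNbrs.2 hadj.2)

/-- Whether an unordered pair joins an outer vertex to a core vertex. -/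
def IsCross (n m : ℕ) (e : Sym2 (Fin n)) : Prop :=
  ∃ (w : Outer n m) (i : Core n m), e = s(w.1, i.1)

lemma cross_injective {n m : ℕ} :
    Function.Injective fun x : Outer n m × Core n m => s(x.1.1, x.2.1) := by
  rintro ⟨w, i⟩ ⟨w', i'⟩ h
  rcases Sym2.eq_iff.1 h with ⟨h1, h2⟩ | ⟨h1, -⟩
  · exact Prod.ext (Subtype.ext h1) (Subtype.ext h2)
  · exact absurd h1 (w.ne i')

open Classical in
/-- The conditional probability, given the core key rings, that no two core vertices are
adjacent. -/
noncomputable def coreFree (q : ℕ) {n m P : ℕ} (p : ℝ) (S : Core n m → Finset (Fin P)) : ℝ :=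
  ∏ e ∈ univ.filter (fun e => ¬ IsCross n m e),
    ∑ b : Bool, (if b then p else 1 - p) * if CoreOK q S e b then 1 else 0

/-- The conditional probability that an outer vertex with key ring `A` is adjacent to exactly
the core vertices in `I`, given the core key rings. -/
noncomputable def nbrProb (q : ℕ) {ι : Type*} [Fintype ι] [DecidableEq ι] {P : ℕ} (p : ℝ)
    (S : ι → Finset (Fin P)) (I : Finset ι) (A : Finset (Fin P)) : ℝ :=
  ∏ i, if i ∈ I then p * shareInd q A (S i) else 1 - p * shareInd q A (S i)

open Classical in
lemma prod_pairs_eq {q n m P : ℕ} (p : ℝ) (D : Core n m → Finset (Outer n m))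
    (S : Fin n → Finset (Fin P)) :
    ∏ e, ∑ b : Bool, (if b then p else 1 - p) *
        (if CrossOK q D S e b ∧ CoreOK (m := m) q (fun i => S i) e b then 1 else 0) =
      coreFree q p (fun i : Core n m => S i) *
        ∏ w : Outer n m, nbrProb q p (fun i : Core n m => S i)
          (univ.filter fun i => w ∈ D i) (S w) := by
  rw [← Finset.prod_filter_not_mul_prod_filter univ (IsCross n m)]
  congr 1
  · refine Finset.prod_congr rfl fun e he => Finset.sum_congr rfl fun b _ => ?_
    have : CrossOK q D S e b := fun w i h =>
      absurd ⟨w, i, h⟩ (Finset.mem_filter.1 he).2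
    simp [this]
  · have himg : univ.filter (IsCross n m) =
        univ.image fun x : Outer n m × Core n m => s(x.1.1, x.2.1) := by
      ext e
      simp only [Finset.mem_filter, Finset.mem_univ, true_and, Finset.mem_image, Prod.exists,
        IsCross, eq_comm]
    rw [himg, Finset.prod_image fun x _ y _ h => cross_injective h, Fintype.prod_prod_type]
    refine Finset.prod_congr rfl fun w _ => Finset.prod_congr rfl fun i _ => ?_
    have hcore : ∀ b, CoreOK (m := m) q (fun i => S i) s(w.1, i.1) b := by
      intro b j k _ h
      rcases Sym2.eq_iff.1 h with ⟨h1, -⟩ | ⟨h1, -⟩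
      · exact absurd h1 (w.ne j)
      · exact absurd h1 (w.ne k)
    have hcross : ∀ b, CrossOK q D S s(w.1, i.1) b ↔
        ((q ≤ (S w ∩ S i).card ∧ b = true) ↔ w ∈ D i) := by
      intro b
      refine ⟨fun h => h w i rfl, fun h w' i' h' => ?_⟩
      have := cross_injective (a₁ := (w, i)) (a₂ := (w', i')) h'
      obtain ⟨rfl, rfl⟩ := Prod.ext_iff.1 this
      exact h
    simp only [hcore, hcross, and_true, Fintype.sum_bool, shareInd, Finset.mem_filter,
      Finset.mem_univ, true_and]
    by_cases h1 : q ≤ (S w ∩ S i).card <;> by_cases h2 : w ∈ D i <;> simp [h1, h2]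

open Classical in
lemma prob_isolatedDegreeEvent (q n K P m h : ℕ) (p : ℝ) :
    prob n K P p (isolatedDegreeEvent q n P m h) =
      ∑ D ∈ patterns n m h, ∑ S : Core n m → Finset (Fin P),
        (∏ i, ringWeight K P (S i)) * (coreFree q p S *
          ∏ w : Outer n m, ringExp K P (nbrProb q p S (univ.filter fun i => w ∈ D i))) := by
  have hind : ∀ ω : Config n P,
      Set.indicator (isolatedDegreeEvent q n P m h) (weight n K P p) ω =
      ∑ D ∈ patterns n m h, (∏ i, ringWeight K P (ω.1 i)) *
        ∏ e, (if ω.2 e then p else 1 - p) *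
          (if CrossOK q D ω.1 e (ω.2 e) ∧ CoreOK (m := m) q (fun i => ω.1 i) e (ω.2 e)
            then 1 else 0) := by
    intro ω
    have hD : ∀ D : Core n m → Finset (Outer n m),
        (∏ i, ringWeight K P (ω.1 i)) * ∏ e, (if ω.2 e then p else 1 - p) *
          (if CrossOK q D ω.1 e (ω.2 e) ∧ CoreOK (m := m) q (fun i => ω.1 i) e (ω.2 e)
            then 1 else 0) =
        if outerNbrs q ω = D then
          (if ∀ e, CoreOK (m := m) q (fun i => ω.1 i) e (ω.2 e) then weight n K P p ω else 0)
        else 0 := by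
      intro D
      rw [Finset.prod_mul_distrib, Fintype.prod_ite_zero]
      simp only [forall_and, crossOK_iff, eq_comm (a := D), ite_and]
      split_ifs <;> simp [weight, ringWeight]
    rw [Finset.sum_congr rfl fun D _ => hD D, Finset.sum_ite_eq]
    simp only [Set.indicator, mem_isolatedDegreeEvent_iff, ite_and]
  simp only [prob, hind]
  rw [Finset.sum_comm]
  refine Finset.sum_congr rfl fun D _ => ?_
  rw [Fintype.sum_prod_type]
  have hc : ∀ S : Fin n → Finset (Fin P), (∑ c : Sym2 (Fin n) → Bool,
      (∏ i, ringWeight K P (S i)) * ∏ e, (if c e then p else 1 - p) *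
          (if CrossOK q D S e (c e) ∧ CoreOK (m := m) q (fun i => S i) e (c e)
            then (1 : ℝ) else 0)) =
      (∏ i, ringWeight K P (S i)) * (coreFree q p (fun i : Core n m => S i) *
        ∏ w : Outer n m, nbrProb q p (fun i : Core n m => S i)
          (univ.filter fun i => w ∈ D i) (S w)) := by
    intro S
    rw [← Finset.mul_sum, ← prod_pairs_eq, Fintype.prod_sum]
  simp only [hc]
  rw [← (Equiv.piEquivPiSubtypeProd (fun i : Fin n => (i : ℕ) < m)
    fun _ => Finset (Fin P)).symm.sum_comp, Fintype.sum_prod_type]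
  refine Finset.sum_congr rfl fun S _ => ?_
  have hw : ∀ w : Outer n m, ringExp K P (nbrProb q p S (univ.filter fun i => w ∈ D i)) =
      ∑ A, ringWeight K P A * nbrProb q p S (univ.filter fun i => w ∈ D i) A := fun _ => rfl
  simp only [hw]
  rw [Fintype.prod_sum, Finset.mul_sum, Finset.mul_sum]
  refine Finset.sum_congr rfl fun R _ => ?_
  rw [← Fintype.prod_subtype_mul_prod_subtype (fun i : Fin n => (i : ℕ) < m)]
  have e1 : ∀ i : Core n m, (Equiv.piEquivPiSubtypeProd (fun i : Fin n => (i : ℕ) < m)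
      fun _ => Finset (Fin P)).symm (S, R) i = S i := fun i => by
    simp [Equiv.piEquivPiSubtypeProd, i.2]
  have e2 : ∀ i : Outer n m, (Equiv.piEquivPiSubtypeProd (fun i : Fin n => (i : ℕ) < m)
      fun _ => Finset (Fin P)).symm (S, R) i = R i := fun i => by
    simp [Equiv.piEquivPiSubtypeProd, i.2]
  simp only [e1, e2, Finset.prod_mul_distrib]
  ring

lemma one_sub_sum_le_prod {ι : Type*} (s : Finset ι) {x : ι → ℝ} (h0 : ∀ i, 0 ≤ x i)
    (h1 : ∀ i, x i ≤ 1) : 1 - ∑ i ∈ s, x i ≤ ∏ i ∈ s, (1 - x i) := by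
  classical
  induction s using Finset.induction_on with
  | empty => simp
  | insert a s ha ih =>
    rw [Finset.sum_insert ha, Finset.prod_insert ha]
    have := mul_le_mul_of_nonneg_left ih (sub_nonneg.2 (h1 a))
    nlinarith [mul_nonneg (h0 a) (Finset.sum_nonneg fun i (_ : i ∈ s) => h0 i)]

lemma prod_le_one_sub_sum_add {ι : Type*} [DecidableEq ι] (s : Finset ι) {x : ι → ℝ}
    (h0 : ∀ i, 0 ≤ x i) (h1 : ∀ i, x i ≤ 1) :
    ∏ i ∈ s, (1 - x i) ≤ 1 - ∑ i ∈ s, x i + ∑ y ∈ s.offDiag, x y.1 * x y.2 := by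
  induction s using Finset.induction_on with
  | empty => simp
  | insert a s ha ih =>
    rw [Finset.sum_insert ha, Finset.prod_insert ha]
    have hsub : s.offDiag ∪ {a} ×ˢ s ⊆ (insert a s).offDiag := by
      rw [Finset.offDiag_insert ha]
      exact Finset.subset_union_left
    have hdisj : Disjoint s.offDiag ({a} ×ˢ s) := by
      refine Finset.disjoint_left.2 fun y hy hy' => ha ?_
      rw [← Finset.mem_singleton.1 (Finset.mem_product.1 hy').1]
      exact (Finset.mem_offDiag.1 hy).1
    have hle := Finset.sum_le_sum_of_subset_of_nonneg (f := fun y : ι × ι => x y.1 * x y.2) hsub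
      fun y _ _ => mul_nonneg (h0 _) (h0 _)
    rw [Finset.sum_union hdisj, Finset.sum_product, Finset.sum_singleton] at hle
    simp only [← Finset.mul_sum] at hle
    have := mul_le_mul_of_nonneg_left (one_sub_sum_le_prod s h0 h1) (h0 a)
    linarith

/-- Sum over ordered pairs of core vertices of the probability that an outer vertex is adjacent
to both. -/
noncomputable def commonNbrSum {ι : Type*} [Fintype ι] (q K : ℕ) {P : ℕ} (p : ℝ)
    (S : ι → Finset (Fin P)) : ℝ :=
  ∑ y ∈ (univ : Finset ι).offDiag,
    ringExp K P (fun A => (p * shareInd q A (S y.1)) * (p * shareInd q A (S y.2)))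

lemma commonNbrSum_le {ι : Type*} [Fintype ι] {q K P : ℕ} {p : ℝ} {S : ι → Finset (Fin P)}
    (hq : 1 ≤ q) (hK : 1 ≤ K) (hKP : K ≤ P) (hS : ∀ i, (S i).card = K) :
    commonNbrSum q K p S ≤ ∑ y ∈ (univ : Finset ι).offDiag,
      (p ^ 2 * (q / K * overlapBound q K P) * (S y.1 ∩ S y.2).card +
        p ^ 2 * overlapBound q K P ^ 2) := by
  refine Finset.sum_le_sum fun y _ => ?_
  have h : (fun A => (p * shareInd q A (S y.1)) * (p * shareInd q A (S y.2))) =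
      fun A => p ^ 2 * (shareInd q A (S y.1) * shareInd q A (S y.2)) := by funext A; ring
  rw [h, ringExp_const_mul]
  refine (mul_le_mul_of_nonneg_left (ringExp_shareInd_mul_le hq hK hKP (hS y.1) (hS y.2))
    (sq_nonneg p)).trans (le_of_eq (by ring))

section NbrProb

variable {ι : Type*} [Fintype ι] [DecidableEq ι] {q K P : ℕ} {p : ℝ} {S : ι → Finset (Fin P)}

lemma mul_shareInd_nonneg (hp : p ∈ Set.Ioc (0 : ℝ) 1) (A B : Finset (Fin P)) :
    0 ≤ p * shareInd q A B :=
  mul_nonneg hp.1.le (shareInd_nonneg _ _ _)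

lemma mul_shareInd_le_one (hp : p ∈ Set.Ioc (0 : ℝ) 1) (A B : Finset (Fin P)) :
    p * shareInd q A B ≤ 1 :=
  mul_le_one₀ hp.2 (shareInd_nonneg _ _ _) (shareInd_le_one _ _ _)

lemma nbrProb_nonneg (hp : p ∈ Set.Ioc (0 : ℝ) 1) (I : Finset ι) (A : Finset (Fin P)) :
    0 ≤ nbrProb q p S I A := by
  refine Finset.prod_nonneg fun i _ => ?_
  split_ifs
  · exact mul_shareInd_nonneg hp _ _
  · exact sub_nonneg.2 (mul_shareInd_le_one hp _ _)

lemma ringExp_mul_shareInd (hKP : K ≤ P) {B : Finset (Fin P)} (hB : B.card = K) :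
    ringExp K P (fun A => p * shareInd q A B) = peq q K P p := by
  rw [ringExp_const_mul, ringExp_shareInd hKP hB, peq]

lemma ringExp_nbrProb_empty_le (hp : p ∈ Set.Ioc (0 : ℝ) 1) (hKP : K ≤ P)
    (hS : ∀ i, (S i).card = K) :
    ringExp K P (nbrProb q p S ∅) ≤
      Real.exp (-(Fintype.card ι * peq q K P p - commonNbrSum q K p S)) := by
  have h : ringExp K P (nbrProb q p S ∅) ≤
      1 - Fintype.card ι * peq q K P p + commonNbrSum q K p S := by
    calc ringExp K P (nbrProb q p S ∅)
        ≤ ringExp K P (fun A => 1 - ∑ i, p * shareInd q A (S i) +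
          ∑ y ∈ (univ : Finset ι).offDiag,
            (p * shareInd q A (S y.1)) * (p * shareInd q A (S y.2))) := by
          refine ringExp_mono fun A _ => ?_
          simpa [nbrProb] using prod_le_one_sub_sum_add univ
            (x := fun i => p * shareInd q A (S i)) (fun i => mul_shareInd_nonneg hp _ _)
            (fun i => mul_shareInd_le_one hp _ _)
      _ = _ := by
          rw [ringExp_add, ringExp_sub, ringExp_one hKP, ringExp_sum, ringExp_sum]
          simp [ringExp_mul_shareInd hKP (hS _), commonNbrSum]
  refine h.trans (le_trans (le_of_eq ?_) (Real.add_one_le_exp _))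
  ring

lemma le_ringExp_nbrProb_empty (hp : p ∈ Set.Ioc (0 : ℝ) 1) (hKP : K ≤ P)
    (hS : ∀ i, (S i).card = K) :
    1 - Fintype.card ι * peq q K P p ≤ ringExp K P (nbrProb q p S ∅) := by
  calc _ = ringExp K P (fun A => 1 - ∑ i, p * shareInd q A (S i)) := by
          rw [ringExp_sub, ringExp_one hKP, ringExp_sum]
          simp [ringExp_mul_shareInd hKP (hS _)]
    _ ≤ _ := by
      refine ringExp_mono fun A _ => ?_
      simpa [nbrProb] using one_sub_sum_le_prod univ
        (x := fun i => p * shareInd q A (S i)) (fun i => mul_shareInd_nonneg hp _ _)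
        (fun i => mul_shareInd_le_one hp _ _)

lemma nbrProb_singleton (i : ι) (A : Finset (Fin P)) :
    nbrProb q p S {i} A =
      p * shareInd q A (S i) * ∏ j ∈ univ.erase i, (1 - p * shareInd q A (S j)) := by
  rw [nbrProb, ← Finset.mul_prod_erase univ _ (Finset.mem_univ i)]
  congr 1
  · simp
  · refine Finset.prod_congr rfl fun j hj => ?_
    simp [Finset.ne_of_mem_erase hj]

lemma ringExp_nbrProb_singleton_le (hp : p ∈ Set.Ioc (0 : ℝ) 1) (hKP : K ≤ P)
    (hS : ∀ i, (S i).card = K) (i : ι) :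
    ringExp K P (nbrProb q p S {i}) ≤ peq q K P p := by
  rw [← ringExp_mul_shareInd hKP (hS i)]
  refine ringExp_mono fun A _ => ?_
  rw [nbrProb_singleton]
  refine mul_le_of_le_one_right (mul_shareInd_nonneg hp _ _) (Finset.prod_le_one ?_ ?_)
  · exact fun j _ => sub_nonneg.2 (mul_shareInd_le_one hp _ _)
  · exact fun j _ => sub_le_self _ (mul_shareInd_nonneg hp _ _)

lemma le_ringExp_nbrProb_singleton (hp : p ∈ Set.Ioc (0 : ℝ) 1) (hKP : K ≤ P)
    (hS : ∀ i, (S i).card = K) (i : ι) :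
    peq q K P p - commonNbrSum q K p S ≤ ringExp K P (nbrProb q p S {i}) := by
  calc _ = ringExp K P (fun A => p * shareInd q A (S i) - ∑ y ∈ (univ : Finset ι).offDiag,
            (p * shareInd q A (S y.1)) * (p * shareInd q A (S y.2))) := by
          rw [ringExp_sub, ringExp_sum, ringExp_mul_shareInd hKP (hS i), commonNbrSum]
    _ ≤ _ := by
      refine ringExp_mono fun A _ => ?_
      rw [nbrProb_singleton]
      have h := mul_le_mul_of_nonneg_left (one_sub_sum_le_prod (univ.erase i)
        (x := fun i => p * shareInd q A (S i)) (fun i => mul_shareInd_nonneg hp _ _)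
        (fun i => mul_shareInd_le_one hp _ _)) (mul_shareInd_nonneg (q := q) hp A (S i))
      refine le_trans ?_ h
      rw [mul_sub, mul_one, Finset.mul_sum]
      gcongr
      have hsub : {i} ×ˢ univ.erase i ⊆ (univ : Finset ι).offDiag := by
        intro y hy
        simp only [Finset.mem_product, Finset.mem_singleton, Finset.mem_erase] at hy
        simp only [Finset.mem_offDiag, Finset.mem_univ, true_and]
        exact fun h => hy.2.1 (h ▸ hy.1)
      have hle := Finset.sum_le_sum_of_subset_of_nonneg
        (f := fun y : ι × ι => (p * shareInd q A (S y.1)) * (p * shareInd q A (S y.2))) hsub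
        fun y _ _ => mul_nonneg (mul_shareInd_nonneg hp _ _) (mul_shareInd_nonneg hp _ _)
      rwa [Finset.sum_product, Finset.sum_singleton] at hle

/-- Expectation over independent key rings indexed by `ι`. -/
noncomputable def ringsExp (K P : ℕ) (F : (ι → Finset (Fin P)) → ℝ) : ℝ :=
  ∑ S : ι → Finset (Fin P), (∏ i, ringWeight K P (S i)) * F S

lemma ringsExp_mono {F G : (ι → Finset (Fin P)) → ℝ}
    (h : ∀ S, (∀ i, (S i).card = K) → F S ≤ G S) : ringsExp K P F ≤ ringsExp K P G := by
  refine Finset.sum_le_sum fun S _ => ?_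
  by_cases hS : ∀ i, (S i).card = K
  · exact mul_le_mul_of_nonneg_left (h S hS)
      (Finset.prod_nonneg fun i _ => ringWeight_nonneg _ _ _)
  · push Not at hS
    obtain ⟨i, hi⟩ := hS
    rw [Finset.prod_eq_zero (Finset.mem_univ i) (by simp [ringWeight, hi])]
    simp

lemma ringsExp_sum {κ : Type*} (s : Finset κ) (F : κ → (ι → Finset (Fin P)) → ℝ) :
    ringsExp K P (fun S => ∑ k ∈ s, F k S) = ∑ k ∈ s, ringsExp K P (F k) := by
  simp only [ringsExp, Finset.mul_sum]
  exact Finset.sum_comm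

lemma ringsExp_const_mul (c : ℝ) (F : (ι → Finset (Fin P)) → ℝ) :
    ringsExp K P (fun S => c * F S) = c * ringsExp K P F := by
  simp only [ringsExp, Finset.mul_sum]
  exact Finset.sum_congr rfl fun S _ => by ring

lemma ringsExp_sub (F G : (ι → Finset (Fin P)) → ℝ) :
    ringsExp K P (fun S => F S - G S) = ringsExp K P F - ringsExp K P G := by
  simp [ringsExp, mul_sub, Finset.sum_sub_distrib]

lemma ringsExp_one (hKP : K ≤ P) : ringsExp (ι := ι) K P (fun _ => 1) = 1 := by
  have h : ∑ A : Finset (Fin P), ringWeight K P A = 1 := by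
    simpa [ringExp] using ringExp_one hKP
  simp only [ringsExp, mul_one]
  rw [← Fintype.prod_sum]
  simp [h]

lemma ringsExp_mul (hKP : K ≤ P) {i j : ι} (hij : i ≠ j) (f g : Finset (Fin P) → ℝ) :
    ringsExp K P (fun S => f (S i) * g (S j)) = ringExp K P f * ringExp K P g := by
  have h1 : ∀ S : ι → Finset (Fin P), (∏ k, ringWeight K P (S k)) * (f (S i) * g (S j)) =
      ∏ k, ringWeight K P (S k) *
        ((if k = i then f (S k) else 1) * (if k = j then g (S k) else 1)) := by
    intro S
    rw [Finset.prod_mul_distrib, Finset.prod_mul_distrib]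
    simp
  have h2 : ∀ k, ∑ A, ringWeight K P A *
      ((if k = i then f A else 1) * (if k = j then g A else 1)) =
      (if k = i then ringExp K P f else 1) * (if k = j then ringExp K P g else 1) := by
    intro k
    by_cases hi : k = i
    · have hj : k ≠ j := fun h => hij (hi.symm.trans h)
      simp [hi, hij, ringExp]
    · by_cases hj : k = j
      · simp [hj, hij.symm, ringExp]
      · simpa [hi, hj, ringExp] using ringExp_one hKP
  simp only [ringsExp, h1]
  rw [← Fintype.prod_sum fun k A => ringWeight K P A *
        ((if k = i then f A else 1) * (if k = j then g A else 1))]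
  simp only [h2]
  rw [Finset.prod_mul_distrib]
  simp

lemma ringsExp_pow_inter_le (hK : 1 ≤ K) (hKP : K ≤ P) {i j : ι} (hij : i ≠ j) {x : ℝ}
    (hx : 1 ≤ x) :
    ringsExp K P (fun S => x ^ (S i ∩ S j).card) ≤ Real.exp ((x - 1) * ((K : ℝ) ^ 2 / P)) := by
  have hP : (0 : ℝ) < P := by exact_mod_cast (show 0 < P by omega)
  have hpt : ∀ S : ι → Finset (Fin P), x ^ (S i ∩ S j).card =
      ∑ U : Finset (Fin P), (x - 1) ^ U.card *
        ((if U ⊆ S i then 1 else 0) * (if U ⊆ S j then 1 else 0)) := by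
    intro S
    have h := Finset.sum_pow_mul_eq_add_pow (x - 1) 1 (S i ∩ S j)
    simp only [one_pow, mul_one, sub_add_cancel] at h
    rw [← h, ← Finset.sum_filter_add_sum_filter_not univ (· ∈ (S i ∩ S j).powerset)]
    rw [Finset.sum_eq_zero (s := univ.filter (· ∉ (S i ∩ S j).powerset)), add_zero]
    · refine Finset.sum_congr (by ext; simp) fun U hU => ?_
      simp only [Finset.mem_filter, Finset.mem_powerset, Finset.subset_inter_iff] at hU
      simp [hU.2]
    · intro U hU
      simp only [Finset.mem_filter, Finset.mem_powerset, Finset.subset_inter_iff] at hU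
      have := hU.2
      by_cases h1 : U ⊆ S i <;> by_cases h2 : U ⊆ S j <;> simp_all
  simp only [hpt]
  rw [ringsExp_sum]
  have hU : ∀ U : Finset (Fin P), ringsExp K P (fun S : ι → Finset (Fin P) => (x - 1) ^ U.card *
        ((if U ⊆ S i then 1 else 0) * (if U ⊆ S j then 1 else 0))) ≤
      ((x - 1) * ((K : ℝ) / P) ^ 2) ^ U.card * 1 ^ (Fintype.card (Fin P) - U.card) := by
    intro U
    rw [ringsExp_const_mul, ringsExp_mul hKP hij (fun A => if U ⊆ A then 1 else 0)
      (fun A => if U ⊆ A then 1 else 0), one_pow, mul_one, mul_pow, ← pow_mul, mul_comm 2,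
      pow_mul, sq]
    have h0 : 0 ≤ x - 1 := by linarith
    have h1 : 0 ≤ ringExp K P (fun A => if U ⊆ A then 1 else 0) :=
      ringExp_nonneg fun A => by positivity
    have h2 := ringExp_superset_le hK hKP U
    gcongr
  refine (Finset.sum_le_sum fun U _ => hU U).trans ?_
  rw [Fintype.sum_pow_mul_eq_add_pow, Fintype.card_fin]
  calc ((x - 1) * ((K : ℝ) / P) ^ 2 + 1) ^ P
      ≤ (Real.exp ((x - 1) * ((K : ℝ) / P) ^ 2)) ^ P := by
        have h0 : 0 ≤ x - 1 := by linarith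
        gcongr
        exact Real.add_one_le_exp _
    _ = _ := by
        rw [← Real.exp_nat_mul]
        congr 1
        field_simp

lemma ringsExp_exp_sum_le (hK : 1 ≤ K) (hKP : K ≤ P) {a b : ℝ} (ha : 0 ≤ a) (hb : 0 ≤ b) :
    ringsExp K P (fun S : ι → Finset (Fin P) =>
      Real.exp (∑ y ∈ (univ : Finset ι).offDiag, (a * (S y.1 ∩ S y.2).card + b))) ≤
      Real.exp ((Fintype.card ι : ℝ) ^ 2 * b +
        (Real.exp ((Fintype.card ι : ℝ) ^ 2 * a) - 1) * ((K : ℝ) ^ 2 / P)) := by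
  set M : ℝ := (Fintype.card ι : ℝ) ^ 2 with hM
  have hM0 : 0 ≤ M := by positivity
  have hR : 1 ≤ Real.exp (M * b + (Real.exp (M * a) - 1) * ((K : ℝ) ^ 2 / P)) := by
    have h1 : 1 ≤ Real.exp (M * a) := Real.one_le_exp (by positivity)
    have h2 : 0 ≤ Real.exp (M * a) - 1 := by linarith
    exact Real.one_le_exp (by positivity)
  rcases Finset.eq_empty_or_nonempty ((univ : Finset ι).offDiag) with hO | hO
  · simpa [hO, ringsExp_one hKP] using hR
  set O := (univ : Finset ι).offDiag with hOdef
  have hOc : (0 : ℝ) < O.card := by exact_mod_cast hO.card_pos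
  have hOM : (O.card : ℝ) ≤ M := by
    rw [hM, hOdef, sq]
    norm_cast
    rw [Finset.offDiag_card, Finset.card_univ]
    exact Nat.sub_le _ _
  have hpt : ∀ S : ι → Finset (Fin P), Real.exp (∑ y ∈ O, (a * (S y.1 ∩ S y.2).card + b)) ≤
      (O.card : ℝ)⁻¹ * ∑ y ∈ O,
        (Real.exp (M * b) * Real.exp (M * a) ^ (S y.1 ∩ S y.2).card) := by
    intro S
    have hj := convexOn_exp.map_sum_le (t := O) (w := fun _ => (O.card : ℝ)⁻¹)
      (p := fun y => (O.card : ℝ) * (a * (S y.1 ∩ S y.2).card + b))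
      (fun _ _ => by positivity) (by simp [hOc.ne']) (fun _ _ => Set.mem_univ _)
    simp only [smul_eq_mul, inv_mul_cancel_left₀ hOc.ne'] at hj
    refine hj.trans ?_
    rw [Finset.mul_sum]
    gcongr with y hy
    rw [← Real.exp_nat_mul, ← Real.exp_add]
    refine Real.exp_le_exp.2 ?_
    calc (O.card : ℝ) * (a * (S y.1 ∩ S y.2).card + b)
        ≤ M * (a * (S y.1 ∩ S y.2).card + b) := by gcongr
      _ = _ := by ring
  refine (ringsExp_mono fun S _ => hpt S).trans ?_
  rw [ringsExp_const_mul, ringsExp_sum, inv_mul_le_iff₀ hOc, ← nsmul_eq_mul]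
  refine Finset.sum_le_card_nsmul _ _ _ fun y hy => ?_
  rw [ringsExp_const_mul, Real.exp_add]
  gcongr
  exact ringsExp_pow_inter_le hK hKP (Finset.mem_offDiag.1 hy).2.2
    (Real.one_le_exp (by positivity))

open Classical in
lemma le_ringsExp_disjoint (hK : 1 ≤ K) (hKP : K ≤ P) :
    1 - (Fintype.card ι : ℝ) ^ 2 * ((K : ℝ) ^ 2 / P) ≤
      ringsExp K P (fun S : ι → Finset (Fin P) =>
        if ∀ i j, i ≠ j → S i ∩ S j = ∅ then 1 else 0) := by
  have hP : (0 : ℝ) < P := by exact_mod_cast (show 0 < P by omega)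
  have hpt : ∀ S : ι → Finset (Fin P), (1 : ℝ) - ∑ y ∈ (univ : Finset ι).offDiag, ∑ x : Fin P,
      ((if {x} ⊆ S y.1 then 1 else 0) * (if {x} ⊆ S y.2 then 1 else 0)) ≤
      if ∀ i j, i ≠ j → S i ∩ S j = ∅ then 1 else 0 := by
    intro S
    split_ifs with h
    · exact sub_le_self _ (by positivity)
    · push Not at h
      obtain ⟨i, j, hij, hx⟩ := h
      obtain ⟨x, hx⟩ := hx
      rw [Finset.mem_inter] at hx
      have h1 := Finset.single_le_sum (s := univ) (f := fun x : Fin P =>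
        ((if {x} ⊆ S i then (1 : ℝ) else 0) * (if {x} ⊆ S j then 1 else 0)))
        (fun _ _ => by positivity) (Finset.mem_univ x)
      have h2 := Finset.single_le_sum (s := (univ : Finset ι).offDiag) (f := fun y => ∑ x : Fin P,
        ((if {x} ⊆ S y.1 then (1 : ℝ) else 0) * (if {x} ⊆ S y.2 then 1 else 0)))
        (fun _ _ => by positivity) (a := (i, j)) (by simp [hij])
      simp only [Finset.singleton_subset_iff, hx, if_true, mul_one] at h1 h2 ⊢
      linarith
  refine le_trans ?_ (ringsExp_mono fun S _ => hpt S)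
  rw [ringsExp_sub, ringsExp_one hKP, ringsExp_sum]
  refine sub_le_sub_left ?_ 1
  calc _ ≤ ∑ y ∈ (univ : Finset ι).offDiag, ((K : ℝ) ^ 2 / P) := by
        refine Finset.sum_le_sum fun y hy => ?_
        rw [ringsExp_sum]
        calc _ ≤ ∑ x : Fin P, ((K : ℝ) / P) * ((K : ℝ) / P) := by
              refine Finset.sum_le_sum fun x _ => ?_
              rw [ringsExp_mul hKP (Finset.mem_offDiag.1 hy).2.2
                (fun A => if {x} ⊆ A then 1 else 0) (fun A => if {x} ⊆ A then 1 else 0)]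
              have h := ringExp_superset_le hK hKP {x}
              rw [Finset.card_singleton, pow_one] at h
              have h0 : 0 ≤ ringExp K P (fun A => if {x} ⊆ A then 1 else 0) :=
                ringExp_nonneg fun A => by positivity
              gcongr
          _ = _ := by
            rw [Finset.sum_const, Finset.card_univ, Fintype.card_fin, nsmul_eq_mul]
            field_simp
    _ ≤ _ := by
      rw [Finset.sum_const, nsmul_eq_mul]
      gcongr
      rw [sq]
      norm_cast
      rw [Finset.offDiag_card, Finset.card_univ]
      exact Nat.sub_le _ _

end NbrProb

section Patterns

variable {n m h : ℕ}

lemma card_core (hmn : m ≤ n) : Fintype.card (Core n m) = m := by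
  have e : Core n m ≃ Fin m :=
    ⟨fun i => ⟨i.1.1, i.2⟩, fun i => ⟨⟨i.1, i.2.trans_le hmn⟩, i.2⟩, fun _ => rfl, fun _ => rfl⟩
  rw [Fintype.card_congr e, Fintype.card_fin]

lemma card_outer (hmn : m ≤ n) : Fintype.card (Outer n m) = n - m := by
  rw [Fintype.card_subtype_compl, Fintype.card_fin]
  exact congrArg (n - ·) (card_core hmn)

lemma card_patterns_le (hmn : m ≤ n) :
    h.factorial ^ m * (patterns n m h).card ≤ n ^ (h * m) := by
  have hsub : patterns n m h ⊆ Fintype.piFinset fun _ => univ.powersetCard h := by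
    intro D hD
    simp only [patterns, Finset.mem_filter] at hD
    simpa [Fintype.mem_piFinset, Finset.mem_powersetCard] using hD.2.1
  have hle := Finset.card_le_card hsub
  rw [Fintype.card_piFinset, Finset.prod_const, Finset.card_powersetCard, Finset.card_univ,
    Finset.card_univ, card_core hmn, card_outer hmn] at hle
  calc h.factorial ^ m * (patterns n m h).card
      ≤ h.factorial ^ m * ((n - m).choose h) ^ m := Nat.mul_le_mul_left _ hle
    _ = ((n - m).descFactorial h) ^ m := by
        rw [← mul_pow, Nat.descFactorial_eq_factorial_mul_choose]
    _ ≤ (n ^ h) ^ m := Nat.pow_le_pow_left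
        ((Nat.descFactorial_le_pow _ _).trans (Nat.pow_le_pow_left (Nat.sub_le _ _) _)) _
    _ = n ^ (h * m) := (pow_mul _ _ _).symm

open Classical in
lemma descFactorial_le_card_patterns (hmn : m ≤ n) :
    (n - m).descFactorial (m * h) ≤ h.factorial ^ m * (patterns n m h).card := by
  have hcard : Fintype.card (Core n m × Fin h ↪ Outer n m) = (n - m).descFactorial (m * h) := by
    rw [Fintype.card_embedding_eq, Fintype.card_prod, Fintype.card_fin, card_core hmn,
      card_outer hmn]
  rw [← hcard, ← Finset.card_univ]
  refine Finset.card_le_mul_card_image_of_maps_to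
    (f := fun (e : Core n m × Fin h ↪ Outer n m) i => univ.image fun k => e (i, k)) ?_ _ ?_
  · intro e _
    simp only [patterns, Finset.mem_filter, Finset.mem_univ, true_and]
    refine ⟨fun i => ?_, fun i j hij => ?_⟩
    · rw [Finset.card_image_of_injective, Finset.card_univ, Fintype.card_fin]
      intro a b hab
      simpa using hab
    · simp only [Finset.disjoint_left, Finset.mem_image, Finset.mem_univ, true_and,
        not_exists, forall_exists_index]
      rintro w a rfl b hb
      have := e.injective hb
      exact hij (Prod.ext_iff.1 this).1.symm
  · intro D hD
    simp only [patterns, Finset.mem_filter, Finset.mem_univ, true_and] at hD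
    have htarget : Fintype.card (∀ i : Core n m, Fin h ↪ D i) = h.factorial ^ m := by
      rw [Fintype.card_pi]
      simp [Fintype.card_embedding_eq, hD.1, Nat.descFactorial_self, card_core hmn]
    rw [← htarget, ← Fintype.card_coe]
    have hmem : ∀ e : {e // e ∈ univ.filter fun e : Core n m × Fin h ↪ Outer n m =>
        (fun i => univ.image fun k => e (i, k)) = D}, ∀ i k, e.1 (i, k) ∈ D i := by
      intro e i k
      rw [← congrFun (Finset.mem_filter.1 e.2).2 i]
      exact Finset.mem_image_of_mem _ (Finset.mem_univ k)
    refine Fintype.card_le_of_injective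
      (fun e i => ⟨fun k => ⟨e.1 (i, k), hmem e i k⟩, fun a b hab => ?_⟩) ?_
    · simpa using hab
    · intro e e' hee
      refine Subtype.ext (DFunLike.ext _ _ fun ⟨i, k⟩ => ?_)
      have := DFunLike.congr_fun (congrFun hee i) k
      exact congrArg Subtype.val this

lemma card_biUnion_pattern (hmn : m ≤ n) {D : Core n m → Finset (Outer n m)}
    (hD : D ∈ patterns n m h) : (univ.biUnion D).card = h * m := by
  simp only [patterns, Finset.mem_filter, Finset.mem_univ, true_and] at hD
  rw [Finset.card_biUnion fun i _ j _ hij => hD.2 i j hij]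
  simp [hD.1, card_core hmn, mul_comm]

lemma prod_ite_biUnion_pattern (hmn : m ≤ n) {D : Core n m → Finset (Outer n m)}
    (hD : D ∈ patterns n m h) (a b : ℝ) :
    (∏ w : Outer n m, if w ∈ univ.biUnion D then a else b) =
      a ^ (h * m) * b ^ (n - m - h * m) := by
  rw [Finset.prod_ite, Finset.prod_const, Finset.prod_const, Finset.filter_not,
    Finset.filter_univ_mem, card_biUnion_pattern hmn hD,
    Finset.card_sdiff_of_subset (Finset.subset_univ _), card_biUnion_pattern hmn hD,
    Finset.card_univ, card_outer hmn]

lemma filter_pattern_eq {D : Core n m → Finset (Outer n m)} (hD : D ∈ patterns n m h)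
    (w : Outer n m) :
    (w ∈ univ.biUnion D ∧ ∃ i, (univ.filter fun i => w ∈ D i) = {i}) ∨
      (w ∉ univ.biUnion D ∧ (univ.filter fun i => w ∈ D i) = ∅) := by
  simp only [patterns, Finset.mem_filter, Finset.mem_univ, true_and] at hD
  by_cases hw : w ∈ univ.biUnion D
  · refine Or.inl ⟨hw, ?_⟩
    obtain ⟨i, -, hi⟩ := Finset.mem_biUnion.1 hw
    refine ⟨i, ?_⟩
    ext j
    simp only [Finset.mem_filter, Finset.mem_univ, true_and, Finset.mem_singleton]
    refine ⟨fun hj => ?_, fun hj => hj ▸ hi⟩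
    by_contra hji
    exact Finset.disjoint_left.1 (hD.2 j i hji) hj hi
  · refine Or.inr ⟨hw, Finset.filter_eq_empty_iff.2 fun i _ hi => hw ?_⟩
    exact Finset.mem_biUnion.2 ⟨i, Finset.mem_univ i, hi⟩

end Patterns

section FiniteBounds

variable {q n m h K P : ℕ} {p : ℝ}

open Classical in
lemma coreFree_factor_mem (hp : p ∈ Set.Ioc (0 : ℝ) 1) (S : Core n m → Finset (Fin P))
    (e : Sym2 (Fin n)) :
    (∑ b : Bool, (if b then p else 1 - p) * if CoreOK q S e b then 1 else 0) ∈
      Set.Icc (0 : ℝ) 1 := by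
  have h0 := hp.1
  have h1 := hp.2
  rw [Fintype.sum_bool]
  by_cases ht : CoreOK q S e true <;> by_cases hf : CoreOK q S e false <;>
    simp only [ht, hf, if_true, if_false, Bool.false_eq_true] <;> constructor <;> linarith

lemma coreFree_nonneg (hp : p ∈ Set.Ioc (0 : ℝ) 1) (S : Core n m → Finset (Fin P)) :
    0 ≤ coreFree q p S :=
  Finset.prod_nonneg fun e _ => (coreFree_factor_mem hp S e).1

lemma coreFree_le_one (hp : p ∈ Set.Ioc (0 : ℝ) 1) (S : Core n m → Finset (Fin P)) :
    coreFree q p S ≤ 1 :=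
  Finset.prod_le_one (fun e _ => (coreFree_factor_mem hp S e).1)
    fun e _ => (coreFree_factor_mem hp S e).2

lemma coreFree_eq_one (hq : 1 ≤ q) {S : Core n m → Finset (Fin P)}
    (hS : ∀ i j, i ≠ j → S i ∩ S j = ∅) : coreFree q p S = 1 := by
  refine Finset.prod_eq_one fun e _ => ?_
  have h : ∀ b, CoreOK q S e b := by
    intro b i j hij _ hb
    rw [hS i j hij, Finset.card_empty] at hb
    omega
  simp [h]

lemma prod_nbrProb_le (hp : p ∈ Set.Ioc (0 : ℝ) 1) (hKP : K ≤ P) (hmn : m ≤ n)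
    {D : Core n m → Finset (Outer n m)} (hD : D ∈ patterns n m h)
    {S : Core n m → Finset (Fin P)} (hS : ∀ i, (S i).card = K) :
    ∏ w : Outer n m, ringExp K P (nbrProb q p S (univ.filter fun i => w ∈ D i)) ≤
      peq q K P p ^ (h * m) *
        Real.exp (-(m * peq q K P p - commonNbrSum q K p S)) ^ (n - m - h * m) := by
  rw [← prod_ite_biUnion_pattern hmn hD]
  refine Finset.prod_le_prod (fun w _ => ringExp_nonneg fun A => nbrProb_nonneg hp _ _)
    fun w _ => ?_
  rcases filter_pattern_eq hD w with ⟨hw, i, hi⟩ | ⟨hw, hi⟩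
  · rw [if_pos hw, hi]
    exact ringExp_nbrProb_singleton_le hp hKP hS i
  · rw [if_neg hw, hi]
    have := ringExp_nbrProb_empty_le (q := q) hp hKP hS
    rwa [card_core hmn] at this

lemma le_prod_nbrProb (hp : p ∈ Set.Ioc (0 : ℝ) 1) (hKP : K ≤ P) (hmn : m ≤ n)
    {D : Core n m → Finset (Outer n m)} (hD : D ∈ patterns n m h)
    {S : Core n m → Finset (Fin P)} (hS : ∀ i, (S i).card = K) {a : ℝ} (ha : 0 ≤ a)
    (ha' : a ≤ peq q K P p - commonNbrSum q K p S) (hm1 : 0 ≤ 1 - m * peq q K P p) :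
    a ^ (h * m) * (1 - m * peq q K P p) ^ (n - m - h * m) ≤
    ∏ w : Outer n m, ringExp K P (nbrProb q p S (univ.filter fun i => w ∈ D i)) := by
  rw [← prod_ite_biUnion_pattern hmn hD]
  refine Finset.prod_le_prod (fun w _ => by split_ifs <;> assumption) fun w _ => ?_
  rcases filter_pattern_eq hD w with ⟨hw, i, hi⟩ | ⟨hw, hi⟩
  · rw [if_pos hw, hi]
    exact ha'.trans (le_ringExp_nbrProb_singleton hp hKP hS i)
  · rw [if_neg hw, hi]
    have := le_ringExp_nbrProb_empty (q := q) hp hKP hS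
    rwa [card_core hmn] at this

lemma peq_nonneg (hp : p ∈ Set.Ioc (0 : ℝ) 1) (hKP : K ≤ P) : 0 ≤ peq q K P p :=
  mul_nonneg hp.1.le (psq_nonneg hKP)

lemma prob_le (hq : 1 ≤ q) (hK : 1 ≤ K) (hp : p ∈ Set.Ioc (0 : ℝ) 1) (hKP : K ≤ P)
    (hmn : m + h * m ≤ n) :
    prob n K P p (isolatedDegreeEvent q n P m h) ≤
      (patterns n m h).card * (peq q K P p ^ (h * m) *
        Real.exp (-((n - m - h * m) * (m * peq q K P p))) *
        Real.exp ((m : ℝ) ^ 2 * (n * (p ^ 2 * overlapBound q K P ^ 2)) +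
          (Real.exp ((m : ℝ) ^ 2 * (n * (p ^ 2 * (q / K * overlapBound q K P)))) - 1) *
            ((K : ℝ) ^ 2 / P))) := by
  have hmn' : m ≤ n := by omega
  rw [prob_isolatedDegreeEvent, ← nsmul_eq_mul]
  refine Finset.sum_le_card_nsmul _ _ _ fun D hD => ?_
  have hpe := peq_nonneg (q := q) hp hKP
  have hB := overlapBound_nonneg q K P
  have hpt : ∀ S : Core n m → Finset (Fin P), (∀ i, (S i).card = K) →
      coreFree q p S *
        ∏ w : Outer n m, ringExp K P (nbrProb q p S (univ.filter fun i => w ∈ D i)) ≤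
      (peq q K P p ^ (h * m) * Real.exp (-((n - m - h * m) * (m * peq q K P p)))) *
        Real.exp (∑ y ∈ (univ : Finset (Core n m)).offDiag,
          (n * (p ^ 2 * (q / K * overlapBound q K P)) * (S y.1 ∩ S y.2).card +
            n * (p ^ 2 * overlapBound q K P ^ 2))) := by
    intro S hS
    have hprod : 0 ≤ ∏ w : Outer n m, ringExp K P
        (nbrProb q p S (univ.filter fun i => w ∈ D i)) :=
      Finset.prod_nonneg fun w _ => ringExp_nonneg fun A => nbrProb_nonneg hp _ _
    refine (mul_le_of_le_one_left hprod (coreFree_le_one hp S)).trans ?_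
    refine (prod_nbrProb_le hp hKP hmn' hD hS).trans ?_
    rw [mul_assoc, ← Real.exp_nat_mul, ← Real.exp_add]
    refine mul_le_mul_of_nonneg_left (Real.exp_le_exp.2 ?_) (pow_nonneg hpe _)
    have hcast : ((n - m - h * m : ℕ) : ℝ) = n - m - h * m := by
      rw [Nat.cast_sub (by omega), Nat.cast_sub hmn']
      push_cast
      ring
    have hle := commonNbrSum_le (p := p) hq hK hKP hS
    have hnn : 0 ≤ commonNbrSum q K p S :=
      Finset.sum_nonneg fun y _ => ringExp_nonneg fun A =>
        mul_nonneg (mul_shareInd_nonneg hp _ _) (mul_shareInd_nonneg hp _ _)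
    have hNn : (n : ℝ) - m - h * m ≤ n := by
      have : (0 : ℝ) ≤ m + h * m := by positivity
      linarith
    have h1 : ((n : ℝ) - m - h * m) * commonNbrSum q K p S ≤
        ∑ y ∈ (univ : Finset (Core n m)).offDiag,
          (n * (p ^ 2 * (q / K * overlapBound q K P)) * (S y.1 ∩ S y.2).card +
            n * (p ^ 2 * overlapBound q K P ^ 2)) := by
      calc _ ≤ (n : ℝ) * commonNbrSum q K p S := by gcongr
        _ ≤ n * ∑ y ∈ (univ : Finset (Core n m)).offDiag,
          (p ^ 2 * (q / K * overlapBound q K P) * (S y.1 ∩ S y.2).card +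
            p ^ 2 * overlapBound q K P ^ 2) := by gcongr
        _ = _ := by
          rw [Finset.mul_sum]
          exact Finset.sum_congr rfl fun y _ => by ring
    rw [hcast]
    linarith
  refine (ringsExp_mono hpt).trans ?_
  rw [ringsExp_const_mul]
  have := ringsExp_exp_sum_le (ι := Core n m) hK hKP
    (a := n * (p ^ 2 * (q / K * overlapBound q K P)))
    (b := n * (p ^ 2 * overlapBound q K P ^ 2)) (by positivity) (by positivity)
  rw [card_core hmn'] at this
  exact mul_le_mul_of_nonneg_left this (by positivity)

open Classical in
lemma le_prob (hq : 1 ≤ q) (hK : 1 ≤ K) (hp : p ∈ Set.Ioc (0 : ℝ) 1) (hKP : K ≤ P)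
    (hmn : m ≤ n) (ha : 0 ≤ peq q K P p - (m : ℝ) ^ 2 * (p ^ 2 * overlapBound q K P ^ 2))
    (hm1 : 0 ≤ 1 - m * peq q K P p) :
    (patterns n m h).card *
      ((peq q K P p - (m : ℝ) ^ 2 * (p ^ 2 * overlapBound q K P ^ 2)) ^ (h * m) *
        (1 - m * peq q K P p) ^ n * (1 - (m : ℝ) ^ 2 * ((K : ℝ) ^ 2 / P))) ≤
      prob n K P p (isolatedDegreeEvent q n P m h) := by
  rw [prob_isolatedDegreeEvent, ← nsmul_eq_mul]
  refine Finset.card_nsmul_le_sum _ _ _ fun D hD => ?_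
  have hpe := peq_nonneg (q := q) hp hKP
  set a := peq q K P p - (m : ℝ) ^ 2 * (p ^ 2 * overlapBound q K P ^ 2) with hadef
  have hpt : ∀ S : Core n m → Finset (Fin P), (∀ i, (S i).card = K) →
      (a ^ (h * m) * (1 - m * peq q K P p) ^ n) *
        (if ∀ i j, i ≠ j → S i ∩ S j = ∅ then 1 else 0) ≤
      coreFree q p S *
        ∏ w : Outer n m, ringExp K P (nbrProb q p S (univ.filter fun i => w ∈ D i)) := by
    intro S hS
    split_ifs with hdis
    · rw [mul_one, coreFree_eq_one hq hdis, one_mul]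
      have hcom : commonNbrSum q K p S ≤ (m : ℝ) ^ 2 * (p ^ 2 * overlapBound q K P ^ 2) := by
        refine (commonNbrSum_le hq hK hKP hS).trans ?_
        calc _ ≤ ∑ y ∈ (univ : Finset (Core n m)).offDiag, p ^ 2 * overlapBound q K P ^ 2 := by
              refine Finset.sum_le_sum fun y hy => ?_
              rw [hdis _ _ (Finset.mem_offDiag.1 hy).2.2]
              simp
          _ ≤ _ := by
            rw [Finset.sum_const, nsmul_eq_mul]
            gcongr
            rw [sq]
            norm_cast
            rw [Finset.offDiag_card, Finset.card_univ, card_core hmn]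
            exact Nat.sub_le _ _
      refine le_trans ?_ (le_prod_nbrProb hp hKP hmn hD hS ha (by linarith) hm1)
      refine mul_le_mul_of_nonneg_left ?_ (pow_nonneg ha _)
      exact pow_le_pow_of_le_one hm1 (sub_le_self _ (by positivity)) (by omega)
    · rw [mul_zero]
      exact mul_nonneg (coreFree_nonneg hp S)
        (Finset.prod_nonneg fun w _ => ringExp_nonneg fun A => nbrProb_nonneg hp _ _)
  refine le_trans ?_ (ringsExp_mono hpt)
  rw [ringsExp_const_mul]
  have := le_ringsExp_disjoint (ι := Core n m) hK hKP
  rw [card_core hmn] at this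
  exact mul_le_mul_of_nonneg_left this (by positivity)

end FiniteBounds

section FiniteRatio

variable {q n m h K P : ℕ} {p : ℝ}

lemma overlapBound_pos (hqK : q ≤ K) (hK : 1 ≤ K) (hKP : K ≤ P) : 0 < overlapBound q K P := by
  have h1 : 0 < K.choose q := Nat.choose_pos hqK
  have h2 : (0 : ℝ) < K := by exact_mod_cast hK
  have h3 : (0 : ℝ) < P := by exact_mod_cast hK.trans hKP
  unfold overlapBound
  positivity

lemma prob_le_mul_exp (hq : 1 ≤ q) (hqK : 2 * q ≤ K) (hp : p ∈ Set.Ioc (0 : ℝ) 1)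
    (hKP : 4 * K ^ 2 ≤ P) (hmn : m + h * m ≤ n) {L : ℝ} (hL : n * peq q K P p ≤ 2 * L) :
    prob n K P p (isolatedDegreeEvent q n P m h) ≤
      (((h.factorial : ℝ) ^ m)⁻¹ * (n * peq q K P p) ^ (h * m) *
        Real.exp (-(m * (n * peq q K P p)))) *
      Real.exp ((m + h * m) * m * peq q K P p +
        ((m : ℝ) ^ 2 * (2 ^ (q + 1)) ^ 2 * (n * peq q K P p ^ 2) +
        ((K : ℝ) ^ 2 / P) * Real.exp ((m : ℝ) ^ 2 * q * 2 ^ (q + 1) * 2 * (p * L / K)))) := by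
  have hK : 1 ≤ K := by omega
  have hKP' : K ≤ P := by nlinarith
  have hpe := peq_nonneg (q := q) hp hKP'
  have hB := overlapBound_nonneg q K P
  have hKpos : (0 : ℝ) < K := by exact_mod_cast hK
  have hp0 := hp.1
  have hpB : p * overlapBound q K P ≤ 2 ^ (q + 1) * peq q K P p := by
    calc p * overlapBound q K P ≤ p * (2 ^ (q + 1) * psq q K P) :=
          mul_le_mul_of_nonneg_left (overlapBound_le_psq hqK hK hKP) hp0.le
      _ = _ := by rw [peq]; ring
  have hcard : ((patterns n m h).card : ℝ) ≤ ((h.factorial : ℝ) ^ m)⁻¹ * (n : ℝ) ^ (h * m) := by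
    rw [le_inv_mul_iff₀ (by positivity)]
    exact_mod_cast card_patterns_le (h := h) (show m ≤ n by omega)
  have e1 : (m : ℝ) ^ 2 * (n * (p ^ 2 * overlapBound q K P ^ 2)) ≤
      (m : ℝ) ^ 2 * (2 ^ (q + 1)) ^ 2 * (n * peq q K P p ^ 2) := by
    calc _ = (m : ℝ) ^ 2 * (n * (p * overlapBound q K P) ^ 2) := by ring
      _ ≤ (m : ℝ) ^ 2 * (n * (2 ^ (q + 1) * peq q K P p) ^ 2) := by gcongr
      _ = _ := by ring
  have e2 : (m : ℝ) ^ 2 * (n * (p ^ 2 * (q / K * overlapBound q K P))) ≤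
      (m : ℝ) ^ 2 * q * 2 ^ (q + 1) * 2 * (p * L / K) := by
    calc _ = (m : ℝ) ^ 2 * q * (p / K) * (n * (p * overlapBound q K P)) := by ring
      _ ≤ (m : ℝ) ^ 2 * q * (p / K) * (n * (2 ^ (q + 1) * peq q K P p)) := by gcongr
      _ = (m : ℝ) ^ 2 * q * (p / K) * 2 ^ (q + 1) * (n * peq q K P p) := by ring
      _ ≤ (m : ℝ) ^ 2 * q * (p / K) * 2 ^ (q + 1) * (2 * L) := by gcongr
      _ = _ := by ring
  have e3 : (Real.exp ((m : ℝ) ^ 2 * (n * (p ^ 2 * (q / K * overlapBound q K P)))) - 1) *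
      ((K : ℝ) ^ 2 / P) ≤ ((K : ℝ) ^ 2 / P) *
        Real.exp ((m : ℝ) ^ 2 * q * 2 ^ (q + 1) * 2 * (p * L / K)) := by
    rw [mul_comm]
    refine mul_le_mul_of_nonneg_left ?_ (by positivity)
    linarith [Real.exp_le_exp.2 e2]
  refine (prob_le hq hK hp hKP' hmn).trans ?_
  calc _ ≤ (((h.factorial : ℝ) ^ m)⁻¹ * (n : ℝ) ^ (h * m)) * (peq q K P p ^ (h * m) *
        Real.exp (-((n - m - h * m) * (m * peq q K P p))) *
        Real.exp ((m : ℝ) ^ 2 * (2 ^ (q + 1)) ^ 2 * (n * peq q K P p ^ 2) +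
        ((K : ℝ) ^ 2 / P) * Real.exp ((m : ℝ) ^ 2 * q * 2 ^ (q + 1) * 2 * (p * L / K)))) := by
        gcongr
    _ = _ := by
        rw [Real.exp_add ((m + h * m) * m * peq q K P p), mul_pow,
          show -(((n : ℝ) - m - h * m) * (m * peq q K P p)) =
            -(m * (n * peq q K P p)) + (m + h * m) * m * peq q K P p by ring, Real.exp_add]
        ring

lemma one_sub_nat_mul_sq_le {t : ℝ} (ht0 : 0 ≤ t) (ht1 : t ≤ 1) (n : ℕ) :
    Real.exp (-(n * t)) * (1 - n * t ^ 2) ≤ (1 - t) ^ n := by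
  have h1 : 1 - t ^ 2 ≤ (1 - t) * Real.exp t := by
    nlinarith [Real.add_one_le_exp t]
  have h2 : 1 - n * t ^ 2 ≤ (1 - t ^ 2) ^ n := by
    have := one_add_mul_le_pow (a := -t ^ 2) (by nlinarith) n
    linarith [this, show (1 + -t ^ 2) ^ n = (1 - t ^ 2) ^ n by ring]
  calc Real.exp (-(n * t)) * (1 - n * t ^ 2)
      ≤ Real.exp (-(n * t)) * ((1 - t) * Real.exp t) ^ n :=
        mul_le_mul_of_nonneg_left
          (h2.trans (pow_le_pow_left₀ (by nlinarith) h1 n)) (Real.exp_pos _).le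
    _ = (1 - t) ^ n := by
        rw [mul_pow, ← Real.exp_nat_mul, mul_left_comm, ← Real.exp_add]
        simp

lemma mul_le_prob (hq : 1 ≤ q) (hqK : 2 * q ≤ K) (hp : p ∈ Set.Ioc (0 : ℝ) 1)
    (hKP : 4 * K ^ 2 ≤ P) (hmn : m + h * m ≤ n) (hn : 1 ≤ n)
    (h1 : 0 ≤ 1 - (m : ℝ) ^ 2 * (2 ^ (q + 1)) ^ 2 * peq q K P p)
    (h2 : m * peq q K P p ≤ 1) (h3 : 0 ≤ 1 - (m : ℝ) ^ 2 * ((K : ℝ) ^ 2 / P)) :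
    (((h.factorial : ℝ) ^ m)⁻¹ * (n * peq q K P p) ^ (h * m) *
        Real.exp (-(m * (n * peq q K P p)))) *
      ((1 - (m + h * m) / n) ^ (h * m) *
        (1 - (m : ℝ) ^ 2 * (2 ^ (q + 1)) ^ 2 * peq q K P p) ^ (h * m) *
        (1 - (m : ℝ) ^ 2 * (n * peq q K P p ^ 2)) * (1 - (m : ℝ) ^ 2 * ((K : ℝ) ^ 2 / P))) ≤
      prob n K P p (isolatedDegreeEvent q n P m h) := by
  have hK : 1 ≤ K := by omega
  have hKP' : K ≤ P := by nlinarith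
  have hpe := peq_nonneg (q := q) hp hKP'
  have hB := overlapBound_nonneg q K P
  have hp0 := hp.1
  have hnpos : (0 : ℝ) < n := by exact_mod_cast hn
  have hpB : p * overlapBound q K P ≤ 2 ^ (q + 1) * peq q K P p := by
    calc p * overlapBound q K P ≤ p * (2 ^ (q + 1) * psq q K P) :=
          mul_le_mul_of_nonneg_left (overlapBound_le_psq hqK hK hKP) hp0.le
      _ = _ := by rw [peq]; ring
  have hsub : peq q K P p * (1 - (m : ℝ) ^ 2 * (2 ^ (q + 1)) ^ 2 * peq q K P p) ≤
      peq q K P p - (m : ℝ) ^ 2 * (p ^ 2 * overlapBound q K P ^ 2) := by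
    have : (m : ℝ) ^ 2 * (p * overlapBound q K P) ^ 2 ≤
      (m : ℝ) ^ 2 * (2 ^ (q + 1) * peq q K P p) ^ 2 := by gcongr
    linarith [this, show (m : ℝ) ^ 2 * (2 ^ (q + 1) * peq q K P p) ^ 2 =
      peq q K P p * ((m : ℝ) ^ 2 * (2 ^ (q + 1)) ^ 2 * peq q K P p) by ring]
  have hsub0 := mul_nonneg hpe h1
  have hcard : ((h.factorial : ℝ) ^ m)⁻¹ * ((n : ℝ) ^ (h * m) * (1 - (m + h * m) / n) ^ (h * m)) ≤
      (patterns n m h).card := by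
    rw [inv_mul_le_iff₀ (by positivity), ← mul_pow, mul_sub, mul_one, mul_div_cancel₀ _ hnpos.ne']
    have hle : (n - (m + h * m)) ^ (h * m) ≤ h.factorial ^ m * (patterns n m h).card := by
      refine le_trans ?_ (descFactorial_le_card_patterns (show m ≤ n by omega))
      rw [mul_comm m h]
      refine le_trans (Nat.pow_le_pow_left ?_ _) (Nat.pow_sub_le_descFactorial _ _)
      omega
    have hcast : ((n - (m + h * m) : ℕ) : ℝ) = n - (m + h * m) := by
      rw [Nat.cast_sub hmn]
      push_cast
      ring
    rw [← hcast]
    exact_mod_cast hle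
  have hpow := one_sub_nat_mul_sq_le (mul_nonneg m.cast_nonneg hpe) h2 n
  refine le_trans ?_ (le_prob hq hK hp hKP' (show m ≤ n by omega) (hsub0.trans hsub) (by linarith))
  have hfrac : (0 : ℝ) ≤ 1 - (m + h * m) / n := by
    rw [sub_nonneg, div_le_one hnpos]
    exact_mod_cast hmn
  calc _ = (((h.factorial : ℝ) ^ m)⁻¹ * ((n : ℝ) ^ (h * m) * (1 - (m + h * m) / n) ^ (h * m))) *
        ((peq q K P p * (1 - (m : ℝ) ^ 2 * (2 ^ (q + 1)) ^ 2 * peq q K P p)) ^ (h * m) *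
        (Real.exp (-(n * (m * peq q K P p))) * (1 - n * (m * peq q K P p) ^ 2)) *
        (1 - (m : ℝ) ^ 2 * ((K : ℝ) ^ 2 / P))) := by
        rw [mul_pow, mul_pow, mul_left_comm (n : ℝ)]
        ring
    _ ≤ (((h.factorial : ℝ) ^ m)⁻¹ * ((n : ℝ) ^ (h * m) * (1 - (m + h * m) / n) ^ (h * m))) *
        ((peq q K P p - (m : ℝ) ^ 2 * (p ^ 2 * overlapBound q K P ^ 2)) ^ (h * m) *
        (1 - m * peq q K P p) ^ n * (1 - (m : ℝ) ^ 2 * ((K : ℝ) ^ 2 / P))) := by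
        refine mul_le_mul_of_nonneg_left (mul_le_mul_of_nonneg_right ?_ h3) (by positivity)
        calc _ ≤ (peq q K P p * (1 - (m : ℝ) ^ 2 * (2 ^ (q + 1)) ^ 2 * peq q K P p)) ^ (h * m) *
              (1 - m * peq q K P p) ^ n :=
              mul_le_mul_of_nonneg_left hpow (pow_nonneg hsub0 _)
          _ ≤ _ := mul_le_mul_of_nonneg_right (pow_le_pow_left₀ hsub0 hsub _)
              (pow_nonneg (by linarith) _)
    _ ≤ _ := by
        refine mul_le_mul_of_nonneg_right hcard (mul_nonneg (mul_nonneg ?_ ?_) h3)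
        · exact pow_nonneg (hsub0.trans hsub) _
        · exact pow_nonneg (by linarith) _

end FiniteRatio

section Asymptotics

lemma tendsto_zero_of_pow {f : ℕ → ℝ} (hf : ∀ n, 0 ≤ f n) {q : ℕ} (hq : 1 ≤ q)
    (h : Tendsto (fun n => f n ^ q) atTop (nhds 0)) : Tendsto f atTop (nhds 0) := by
  have hpos : (0 : ℝ) < (q : ℝ)⁻¹ := by positivity
  have := h.rpow_const (p := (q : ℝ)⁻¹) (Or.inr hpos.le)
  rw [Real.zero_rpow hpos.ne'] at this
  exact this.congr fun n => Real.pow_rpow_inv_natCast (hf n) (by omega)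

lemma tendsto_log_natCast : Tendsto (fun n : ℕ => Real.log n) atTop atTop :=
  Real.tendsto_log_atTop.comp tendsto_natCast_atTop_atTop

lemma tendsto_pow_mul_exp_neg_half (k : ℕ) :
    Tendsto (fun x : ℝ => x ^ k * Real.exp (-(x / 2))) atTop (nhds 0) := by
  have := ((Real.tendsto_pow_mul_exp_neg_atTop_nhds_zero k).comp
    (tendsto_id.atTop_div_const (zero_lt_two' ℝ))).const_mul (2 ^ k)
  rw [mul_zero] at this
  refine this.congr fun x => ?_
  simp only [Function.comp, id, div_pow]
  field_simp

lemma tendsto_log_pow_div (k : ℕ) :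
    Tendsto (fun n : ℕ => Real.log n ^ k / n) atTop (nhds 0) := by
  have := (Real.tendsto_pow_mul_exp_neg_atTop_nhds_zero k).comp tendsto_log_natCast
  refine this.congr' ?_
  filter_upwards [eventually_ge_atTop 1] with n hn
  have : (0 : ℝ) < n := by exact_mod_cast hn
  simp only [Function.comp, Real.exp_neg, Real.exp_log this, div_eq_mul_inv]

lemma tendsto_mul_exp_zero {q : ℕ} (hq : 1 ≤ q) {z K p : ℕ → ℝ} {c C : ℝ} (hc : 0 ≤ c)
    (hz0 : ∀ n, 0 ≤ z n) (hz : Tendsto z atTop (nhds 0)) (hK1 : ∀ n, 1 ≤ K n)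
    (hK : Tendsto K atTop atTop) (hp : ∀ n, p n ∈ Set.Ioc (0 : ℝ) 1)
    (hpz : ∀ᶠ n : ℕ in atTop, p n * z n ^ q ≤ C * (Real.log n / n)) :
    Tendsto (fun n : ℕ => z n * Real.exp (c * (p n * Real.log n / K n))) atTop (nhds 0) := by
  refine tendsto_zero_of_pow (fun n => mul_nonneg (hz0 n) (Real.exp_pos _).le) hq ?_
  have hlim : Tendsto (fun n : ℕ => Real.exp (q * c) * z n ^ q +
      |C| * (Real.log n ^ 2 * Real.exp (-(Real.log n / 2)))) atTop (nhds 0) := by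
    have h1 := (hz.pow q).const_mul (Real.exp (q * c))
    have h2 := ((tendsto_pow_mul_exp_neg_half 2).comp tendsto_log_natCast).const_mul |C|
    simpa [zero_pow (show q ≠ 0 by omega)] using h1.add h2
  refine tendsto_of_tendsto_of_tendsto_of_le_of_le' tendsto_const_nhds hlim
    (Eventually.of_forall fun n => pow_nonneg (mul_nonneg (hz0 n) (Real.exp_pos _).le) _) ?_
  filter_upwards [hpz, hK.eventually_ge_atTop (2 * (q * c)), eventually_ge_atTop 1]
    with n hn hKn hn1
  have hnpos : (0 : ℝ) < n := by exact_mod_cast hn1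
  have hl : 0 ≤ Real.log n := Real.log_nonneg (by exact_mod_cast hn1)
  have hKpos : 0 < K n := zero_lt_one.trans_le (hK1 n)
  have hp0 := (hp n).1
  have hp1 := (hp n).2
  have hzq : 0 ≤ z n ^ q := pow_nonneg (hz0 n) q
  rw [mul_pow, ← Real.exp_nat_mul]
  rcases le_total (p n * Real.log n) 1 with hs | hs
  · have hexp : (q : ℝ) * (c * (p n * Real.log n / K n)) ≤ q * c := by
      have : p n * Real.log n / K n ≤ 1 := by
        rw [div_le_one hKpos]
        exact hs.trans (hK1 n)
      calc _ ≤ (q : ℝ) * (c * 1) := by gcongr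
        _ = _ := by ring
    calc _ ≤ z n ^ q * Real.exp (q * c) := by gcongr
      _ = Real.exp (q * c) * z n ^ q := mul_comm _ _
      _ ≤ _ := le_add_of_nonneg_right (by positivity)
  · have hexp : (q : ℝ) * (c * (p n * Real.log n / K n)) ≤ Real.log n / 2 := by
      calc (q : ℝ) * (c * (p n * Real.log n / K n)) = (q * c / K n) * (p n * Real.log n) := by ring
        _ ≤ (1 / 2) * (1 * Real.log n) := by
          have : q * c / K n ≤ 1 / 2 := by
            rw [div_le_iff₀ hKpos]
            linarith
          exact mul_le_mul this (by gcongr) (by positivity) (by norm_num)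
        _ = _ := by ring
    have hzb : z n ^ q ≤ |C| * (Real.log n ^ 2 * Real.exp (-Real.log n)) := by
      calc z n ^ q ≤ z n ^ q * (p n * Real.log n) := le_mul_of_one_le_right hzq hs
        _ = p n * z n ^ q * Real.log n := by ring
        _ ≤ C * (Real.log n / n) * Real.log n := by gcongr
        _ ≤ |C| * (Real.log n / n) * Real.log n := by gcongr; exact le_abs_self C
        _ = _ := by rw [Real.exp_neg, Real.exp_log hnpos]; ring
    calc _ ≤ |C| * (Real.log n ^ 2 * Real.exp (-Real.log n)) * Real.exp (Real.log n / 2) := by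
          gcongr
      _ = |C| * (Real.log n ^ 2 * Real.exp (-(Real.log n / 2))) := by
          rw [mul_assoc, mul_assoc, ← Real.exp_add]
          congr 4
          ring
      _ ≤ _ := le_add_of_nonneg_left (by positivity)

lemma eventually_le_two_mul_log {y : ℕ → ℝ} {C : ℝ}
    (hC : ∀ᶠ n : ℕ in atTop, |(y n - Real.log n) / Real.log (Real.log n)| ≤ C) :
    ∀ᶠ n : ℕ in atTop, y n ≤ 2 * Real.log n := by
  have hlim : Tendsto (fun n : ℕ => C * (Real.log (Real.log n) / Real.log n)) atTop (nhds 0) := by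
    have := (Real.isLittleO_log_id_atTop.tendsto_div_nhds_zero.comp tendsto_log_natCast).const_mul C
    simpa [Function.comp_def] using this
  filter_upwards [hC, hlim.eventually_le_const zero_lt_one,
    tendsto_log_natCast.eventually_gt_atTop 1] with n hn hn1 hlog
  have hll : 0 < Real.log (Real.log n) := Real.log_pos hlog
  rw [abs_div, abs_of_pos hll, div_le_iff₀ hll] at hn
  rw [← mul_div_assoc, div_le_one (by linarith)] at hn1
  linarith [le_abs_self (y n - Real.log n)]

end Asymptotics

/-- if `K_n → ∞`, `K_n²/P_n → 0` and `(n p_{e,q}(n) − ln n)/ln ln n`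
is bounded, then, for fixed `m ≥ 1` and `h ≥ 0`, the probability that the first
`m` vertices all have degree exactly `h`, that no two of them are adjacent and
that no other vertex is adjacent to two or more of them is asymptotically
equivalent to `(h!)^{−m} (n p_{e,q}(n))^{hm} e^{−m n p_{e,q}(n)}`. -/
theorem prob_degree_h_without_dependency_asymptotics
    (q : ℕ) (hq : 1 ≤ q) (m : ℕ) (hm : 1 ≤ m) (h : ℕ)
    (K P : ℕ → ℕ) (p : ℕ → ℝ)
    (hK1 : ∀ n, 1 ≤ K n) (hKP : ∀ n, K n ≤ P n)
    (hp : ∀ n, p n ∈ Set.Ioc (0 : ℝ) 1)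
    (hKinf : Tendsto (fun n => (K n : ℝ)) atTop atTop)
    (hKsqP : Tendsto (fun n => ((K n : ℝ)) ^ 2 / (P n : ℝ)) atTop (nhds 0))
    (hbounded : ∃ C : ℝ, ∀ᶠ (n : ℕ) in atTop,
      |((n : ℝ) * peq q (K n) (P n) (p n) - Real.log (n : ℝ)) / Real.log (Real.log (n : ℝ))| ≤ C) :
    Tendsto (fun n =>
        prob n (K n) (P n) (p n)
            {ω | (∀ i : Fin n, (i : ℕ) < m → degree q n (P n) ω i = h) ∧
              (∀ i j : Fin n, (i : ℕ) < m → (j : ℕ) < m → ¬ Adj q n (P n) ω i j) ∧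
              (∀ w i j : Fin n, m ≤ (w : ℕ) → (i : ℕ) < m → (j : ℕ) < m → i ≠ j →
                ¬ (Adj q n (P n) ω w i ∧ Adj q n (P n) ω w j))} /
          (((Nat.factorial h : ℝ) ^ m)⁻¹ *
            ((n : ℝ) * peq q (K n) (P n) (p n)) ^ (h * m) *
            Real.exp (-((m : ℝ) * ((n : ℝ) * peq q (K n) (P n) (p n))))))
      atTop (nhds 1) := by
  obtain ⟨C, hC⟩ := hbounded
  set c : ℝ := 2 ^ (q + 1)
  have hzlt : ∀ᶠ n in atTop, (K n : ℝ) ^ 2 / P n ≤ 1 / 4 :=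
    hKsqP.eventually_le_const (by norm_num)
  have hKP4 : ∀ᶠ n in atTop, 4 * K n ^ 2 ≤ P n := by
    filter_upwards [hzlt] with n hn
    have hP : (0 : ℝ) < P n := by exact_mod_cast (hK1 n).trans (hKP n)
    rw [div_le_iff₀ hP] at hn
    have : (4 * K n ^ 2 : ℝ) ≤ P n := by linarith
    exact_mod_cast this
  have hqK : ∀ᶠ n in atTop, 2 * q ≤ K n := by
    filter_upwards [hKinf.eventually_ge_atTop ((2 * q : ℕ) : ℝ)] with n hn
    exact_mod_cast hn
  have hy := eventually_le_two_mul_log hC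
  have hpe0 : ∀ n, 0 ≤ peq q (K n) (P n) (p n) := fun n => peq_nonneg (hp n) (hKP n)
  have hpele : ∀ᶠ n : ℕ in atTop, peq q (K n) (P n) (p n) ≤ 2 * (Real.log n / n) := by
    filter_upwards [hy, eventually_ge_atTop 1] with n hn hn1
    have hnpos : (0 : ℝ) < n := by exact_mod_cast hn1
    rw [← mul_div_assoc, le_div_iff₀ hnpos]
    linarith
  have hpe : Tendsto (fun n => peq q (K n) (P n) (p n)) atTop (nhds 0) := by
    refine tendsto_of_tendsto_of_tendsto_of_le_of_le' tendsto_const_nhds ?_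
      (Eventually.of_forall hpe0) hpele
    simpa using (tendsto_log_pow_div 1).const_mul 2
  have hpe2 : Tendsto (fun n : ℕ => n * peq q (K n) (P n) (p n) ^ 2) atTop (nhds 0) := by
    refine tendsto_of_tendsto_of_tendsto_of_le_of_le' tendsto_const_nhds
      (by simpa using (tendsto_log_pow_div 2).const_mul 4)
      (Eventually.of_forall fun n => by positivity) ?_
    filter_upwards [hpele, eventually_ge_atTop 1] with n hn hn1
    have hnpos : (0 : ℝ) < n := by exact_mod_cast hn1
    calc n * peq q (K n) (P n) (p n) ^ 2 ≤ n * (2 * (Real.log n / n)) ^ 2 := by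
          gcongr
          exact hpe0 n
      _ = 4 * (Real.log n ^ 2 / n) := by
          field_simp
          ring
  have hexp : Tendsto (fun n : ℕ => (K n : ℝ) ^ 2 / P n *
      Real.exp ((m : ℝ) ^ 2 * q * c * 2 * (p n * Real.log n / K n))) atTop (nhds 0) := by
    refine tendsto_mul_exp_zero (C := 2 ^ q * q.factorial * (c * 2)) hq (by positivity)
      (fun n => by positivity) hKsqP (fun n => by exact_mod_cast hK1 n) hKinf hp ?_
    filter_upwards [hpele, hKP4, hqK] with n hn hKPn hqKn
    have hp0 := (hp n).1.le
    calc p n * ((K n : ℝ) ^ 2 / P n) ^ q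
        ≤ p n * (2 ^ q * q.factorial * (c * psq q (K n) (P n))) := by
          gcongr
          exact (pow_le_overlapBound hqKn).trans
            (mul_le_mul_of_nonneg_left (overlapBound_le_psq hqKn (hK1 n) hKPn) (by positivity))
      _ = 2 ^ q * q.factorial * c * peq q (K n) (P n) (p n) := by rw [peq]; ring
      _ ≤ 2 ^ q * q.factorial * c * (2 * (Real.log n / n)) := by gcongr
      _ = _ := by ring
  have hpos : ∀ᶠ n : ℕ in atTop, 0 < ((Nat.factorial h : ℝ) ^ m)⁻¹ *
      ((n : ℝ) * peq q (K n) (P n) (p n)) ^ (h * m) *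
      Real.exp (-((m : ℝ) * ((n : ℝ) * peq q (K n) (P n) (p n)))) := by
    filter_upwards [hKP4, hqK, eventually_ge_atTop 1] with n hKPn hqKn hn1
    have hnpos : (0 : ℝ) < n := by exact_mod_cast hn1
    have hB := (overlapBound_pos (show q ≤ K n by omega) (hK1 n) (hKP n)).trans_le
      (overlapBound_le_psq hqKn (hK1 n) hKPn)
    have hpe : 0 < peq q (K n) (P n) (p n) :=
      mul_pos (hp n).1 (pos_of_mul_pos_right hB (by positivity))
    positivity
  have hlower : Tendsto (fun n : ℕ => (1 - (m + h * m : ℝ) / n) ^ (h * m) *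
      (1 - (m : ℝ) ^ 2 * c ^ 2 * peq q (K n) (P n) (p n)) ^ (h * m) *
      (1 - (m : ℝ) ^ 2 * (n * peq q (K n) (P n) (p n) ^ 2)) *
      (1 - (m : ℝ) ^ 2 * ((K n : ℝ) ^ 2 / P n))) atTop (nhds 1) := by
    have h1 := ((tendsto_const_div_atTop_nhds_zero_nat (m + h * m : ℝ)).const_sub 1).pow (h * m)
    have h2 := ((hpe.const_mul ((m : ℝ) ^ 2 * c ^ 2)).const_sub 1).pow (h * m)
    have h3 := (hpe2.const_mul ((m : ℝ) ^ 2)).const_sub 1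
    have h4 := (hKsqP.const_mul ((m : ℝ) ^ 2)).const_sub 1
    simpa using ((h1.mul h2).mul h3).mul h4
  have hupper : Tendsto (fun n : ℕ => Real.exp ((m + h * m) * m * peq q (K n) (P n) (p n) +
      ((m : ℝ) ^ 2 * c ^ 2 * (n * peq q (K n) (P n) (p n) ^ 2) +
      (K n : ℝ) ^ 2 / P n *
        Real.exp ((m : ℝ) ^ 2 * q * c * 2 * (p n * Real.log n / K n))))) atTop (nhds 1) := by
    have := ((hpe.const_mul ((m + h * m) * m : ℝ)).add
      ((hpe2.const_mul ((m : ℝ) ^ 2 * c ^ 2)).add hexp)).rexp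
    simpa using this
  refine tendsto_of_tendsto_of_tendsto_of_le_of_le' hlower hupper ?_ ?_
  · have e1 := (hpe.const_mul ((m : ℝ) ^ 2 * c ^ 2)).eventually_le_const (u := 1) (by simp)
    have e2 := (hpe.const_mul (m : ℝ)).eventually_le_const (u := 1) (by simp)
    have e3 := (hKsqP.const_mul ((m : ℝ) ^ 2)).eventually_le_const (u := 1) (by simp)
    filter_upwards [hpos, hKP4, hqK, e1, e2, e3, eventually_ge_atTop (m + h * m),
      eventually_ge_atTop 1] with n hDn hKPn hqKn h1 h2 h3 hmn hn1
    rw [le_div_iff₀ hDn, mul_comm]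
    exact mul_le_prob hq hqKn (hp n) hKPn hmn hn1 (sub_nonneg.2 h1) h2 (sub_nonneg.2 h3)
  · filter_upwards [hpos, hKP4, hqK, hy, eventually_ge_atTop (m + h * m)]
      with n hDn hKPn hqKn hyn hmn
    rw [div_le_iff₀ hDn, mul_comm]
    exact prob_le_mul_exp hq hqKn (hp n) hKPn hmn hyn
end

section
/- If K_n → ∞ and K_n²/P_n → 0 as n → ∞ (so in particular P_n ≥ 2K_n for all sufficiently large n), then p_{s,q}(n) / ((1/q!)·(K_n²/P_n)^q) → 1 as n → ∞; i.e., p_{s,q}(n) is asymptotically equivalent to (1/q!)·(K_n²/P_n)^q. -/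
open Filter

theorem sum_choose_mul_choose_mul_choose {j K P : ℕ} (hj : j ≤ K) (hKP : K ≤ P) :
    ∑ u ∈ Finset.range (K + 1), K.choose u * u.choose j * (P - K).choose (K - u) =
      K.choose j * (P - j).choose (K - j) := by
  obtain ⟨m, rfl⟩ := Nat.exists_eq_add_of_le hj
  rw [add_assoc, Finset.sum_range_add, Finset.sum_eq_zero, zero_add]
  · have h : P - j = m + (P - (j + m)) := by omega
    rw [h, Nat.add_choose_eq m, add_tsub_cancel_left,
      Finset.Nat.sum_antidiagonal_eq_sum_range_succ
        (fun a b => m.choose a * (P - (j + m)).choose b), Finset.mul_sum]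
    refine Finset.sum_congr rfl fun x hx => ?_
    have hx' : x ≤ m := by simpa [Nat.lt_succ_iff] using hx
    rw [Nat.choose_mul (by omega), add_tsub_cancel_left, add_tsub_cancel_left,
      Nat.add_sub_add_left, mul_assoc]
  · intro u hu
    rw [Nat.choose_eq_zero_of_lt (Finset.mem_range.mp hu)]
    simp

theorem sum_choose_mul_choose_mul_choose_div {j K P : ℕ} (hj : j ≤ K) (hKP : K ≤ P) :
    ∑ u ∈ Finset.range (K + 1),
        (u.choose j : ℝ) * ((K.choose u : ℝ) * ((P - K).choose (K - u) : ℝ) / (P.choose K : ℝ)) =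
      (K.choose j : ℝ) ^ 2 / (P.choose j : ℝ) := by
  have h := congrArg (Nat.cast (R := ℝ)) (sum_choose_mul_choose_mul_choose hj hKP)
  have h2 := congrArg (Nat.cast (R := ℝ)) (Nat.choose_mul (n := P) hj)
  push_cast at h h2
  have hPK : (P.choose K : ℝ) ≠ 0 := by exact_mod_cast (Nat.choose_pos hKP).ne'
  have hPj : (P.choose j : ℝ) ≠ 0 := by exact_mod_cast (Nat.choose_pos (hj.trans hKP)).ne'
  have e : ∀ u, (u.choose j : ℝ) *
      ((K.choose u : ℝ) * ((P - K).choose (K - u) : ℝ) / (P.choose K : ℝ)) =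
      ((K.choose u : ℝ) * u.choose j * ((P - K).choose (K - u) : ℝ)) / (P.choose K : ℝ) :=
    fun u => by ring
  simp_rw [e]
  rw [← Finset.sum_div, h, div_eq_div_iff hPK hPj]
  linear_combination -(K.choose j : ℝ) * h2

theorem psq_eq_sum_ite {q K P : ℕ} (hq : q ≤ K) (hKP : K ≤ P) :
    psq q K P = ∑ u ∈ Finset.range (K + 1), (if q ≤ u then (1 : ℝ) else 0) *
      ((K.choose u : ℝ) * ((P - K).choose (K - u) : ℝ) / (P.choose K : ℝ)) := by
  have h := sum_choose_mul_choose_mul_choose_div (Nat.zero_le K) hKP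
  simp only [Nat.choose_zero_right, Nat.cast_one, one_mul, one_pow, div_one] at h
  rw [psq, sub_eq_iff_eq_add']
  refine h.symm.trans ?_
  obtain ⟨m, rfl⟩ := Nat.exists_eq_add_of_le hq
  rw [add_assoc, Finset.sum_range_add _ q, Finset.sum_range_add _ q, add_right_inj]
  rw [Finset.sum_eq_zero (s := Finset.range q), zero_add]
  · simp
  · intro u hu
    rw [if_neg (by simpa using hu), zero_mul]

theorem psq_le {q K P : ℕ} (hq : q ≤ K) (hKP : K ≤ P) :
    psq q K P ≤ (K.choose q : ℝ) ^ 2 / (P.choose q : ℝ) := by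
  rw [psq_eq_sum_ite hq hKP, ← sum_choose_mul_choose_mul_choose_div hq hKP]
  refine Finset.sum_le_sum fun u _ => mul_le_mul_of_nonneg_right ?_ (by positivity)
  split_ifs with h
  · exact_mod_cast Nat.choose_pos h
  · positivity

theorem choose_le_ite_add (q u : ℕ) :
    u.choose q ≤ (if q ≤ u then 1 else 0) + (q + 1) * u.choose (q + 1) := by
  rcases lt_trichotomy u q with h | rfl | h
  · simp [Nat.choose_eq_zero_of_lt h]
  · simp
  · rw [mul_comm, Nat.choose_succ_right_eq]
    exact (Nat.le_mul_of_pos_right _ (by omega)).trans (Nat.le_add_left _ _)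

theorem le_psq {q K P : ℕ} (hq : q + 1 ≤ K) (hKP : K ≤ P) :
    (K.choose q : ℝ) ^ 2 / (P.choose q : ℝ) -
      (q + 1) * ((K.choose (q + 1) : ℝ) ^ 2 / (P.choose (q + 1) : ℝ)) ≤ psq q K P := by
  rw [psq_eq_sum_ite (by omega) hKP, ← sum_choose_mul_choose_mul_choose_div hq hKP,
    ← sum_choose_mul_choose_mul_choose_div (by omega : q ≤ K) hKP, sub_le_iff_le_add,
    Finset.mul_sum, ← Finset.sum_add_distrib]
  refine Finset.sum_le_sum fun u _ => ?_
  rw [← mul_assoc, ← add_mul]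
  refine mul_le_mul_of_nonneg_right ?_ (by positivity)
  exact_mod_cast choose_le_ite_add q u

theorem tendsto_choose_sq_div_choose {K P : ℕ → ℕ} (hK : Tendsto K atTop atTop)
    (hP : Tendsto P atTop atTop) (j : ℕ) :
    Tendsto (fun n => ((K n).choose j : ℝ) ^ 2 / ((P n).choose j : ℝ) /
      ((1 / (Nat.factorial j : ℝ)) * ((K n : ℝ) ^ 2 / (P n : ℝ)) ^ j)) atTop (nhds 1) := by
  have hKe := (isEquivalent_choose j).comp_tendsto hK
  have hPe := (isEquivalent_choose j).comp_tendsto hP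
  have h := (hKe.pow 2).div hPe
  refine (Asymptotics.isEquivalent_iff_tendsto_one ?_).mp (h.congr_right ?_)
  · filter_upwards [hK.eventually_gt_atTop 0, hP.eventually_gt_atTop 0] with n h1 h2
    positivity
  · refine Eventually.of_forall fun n => ?_
    have : (Nat.factorial j : ℝ) ≠ 0 := by positivity
    simp only [Pi.div_apply, Pi.pow_apply, Function.comp_apply]
    rw [div_pow _ _ j, ← pow_mul, mul_comm 2 j, pow_mul]
    field_simp

/-- if `K_n → ∞` and `K_n²/P_n → 0`, then
`p_{s,q}(n) ∼ (1/q!) (K_n²/P_n)^q`, i.e. the ratio tends to `1`. -/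
theorem psq_asymptotics
    (q : ℕ) (hq : 1 ≤ q)
    (K P : ℕ → ℕ)
    (hK1 : ∀ n, 1 ≤ K n) (hKP : ∀ n, K n ≤ P n)
    (hKinf : Tendsto (fun n => (K n : ℝ)) atTop atTop)
    (hKsqP : Tendsto (fun n => ((K n : ℝ)) ^ 2 / (P n : ℝ)) atTop (nhds 0)) :
    Tendsto (fun n => psq q (K n) (P n) /
        ((1 / (Nat.factorial q : ℝ)) * (((K n : ℝ)) ^ 2 / (P n : ℝ)) ^ q))
      atTop (nhds 1) := by
  have hK : Tendsto K atTop atTop := tendsto_natCast_atTop_iff.mp hKinf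
  have hP : Tendsto P atTop atTop := tendsto_atTop_mono hKP hK
  have hmain := tendsto_choose_sq_div_choose hK hP q
  have hlower := hmain.sub ((tendsto_choose_sq_div_choose hK hP (q + 1)).mul hKsqP)
  rw [one_mul, sub_zero] at hlower
  refine tendsto_of_tendsto_of_tendsto_of_le_of_le' hlower hmain ?_ ?_
  · filter_upwards [hK.eventually_ge_atTop (q + 1)] with n hn
    have hK0 : (0 : ℝ) < K n := by exact_mod_cast hK1 n
    have hP0 : (0 : ℝ) < P n := by exact_mod_cast (hK1 n).trans (hKP n)
    refine le_trans (le_of_eq ?_)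
      (div_le_div_of_nonneg_right (le_psq hn (hKP n)) (by positivity))
    rw [sub_div, Nat.factorial_succ]
    push_cast
    congr 1
    generalize ((K n).choose (q + 1) : ℝ) ^ 2 / ((P n).choose (q + 1) : ℝ) = M
    have hx : (0 : ℝ) < (K n : ℝ) ^ 2 / (P n : ℝ) := by positivity
    generalize (K n : ℝ) ^ 2 / (P n : ℝ) = x at hx ⊢
    rw [pow_succ]
    field_simp
  · filter_upwards [hK.eventually_ge_atTop q] with n hn
    exact div_le_div_of_nonneg_right (psq_le hn (hKP n)) (by positivity)
end

section
/- If K_n/ln n → ∞ and (K_n²/P_n)·ln n → 0 as n → ∞ (so in particular P_n ≥ 2K_n for all sufficiently large n), then p_{s,q}(n) = (1/q!)·(K_n²/P_n)^q · (1 + ε_n) for a sequence ε_n with ε_n·ln n → 0; equivalently, ln n · (p_{s,q}(n)/((1/q!)·(K_n²/P_n)^q) − 1) → 0 as n → ∞. -/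
open Filter

namespace Nat

theorem sum_choose_mul_choose_mul_choose {r K P : ℕ} (hr : r ≤ K) (hKP : K ≤ P) :
    ∑ u ∈ Finset.range (K + 1), K.choose u * (P - K).choose (K - u) * u.choose r =
      K.choose r * (P - r).choose (K - r) := by
  obtain ⟨m, rfl⟩ := Nat.exists_eq_add_of_le hr
  rw [add_assoc, Finset.sum_range_add, Finset.sum_eq_zero, zero_add]
  · have hP : P - r = m + (P - (r + m)) := by omega
    rw [Nat.add_sub_cancel_left, hP, Nat.add_choose_eq m (P - (r + m)) m,
      Finset.Nat.sum_antidiagonal_eq_sum_range_succ_mk, Finset.mul_sum]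
    refine Finset.sum_congr rfl fun x hx => ?_
    have h := Nat.choose_mul (n := r + m) (k := r + x) (s := r) (by omega)
    simp only [Nat.add_sub_cancel_left] at h
    rw [show r + m - (r + x) = m - x by omega, mul_right_comm, h, mul_assoc]
  · intro u hu
    rw [Nat.choose_eq_zero_of_lt (Finset.mem_range.mp hu), mul_zero]

theorem choose_mul_pow_le_choose_mul_pow {K P : ℕ} (hKP : K ≤ P) (r : ℕ) :
    K.choose r * P ^ r ≤ P.choose r * K ^ r := by
  induction r with
  | zero => simp
  | succ r ih =>
    have h : (K - r) * P ≤ (P - r) * K := by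
      rw [Nat.sub_mul, Nat.sub_mul, mul_comm P K]
      exact Nat.sub_le_sub_left (Nat.mul_le_mul_left r hKP) _
    refine Nat.le_of_mul_le_mul_right ?_ (Nat.succ_pos r)
    calc K.choose (r + 1) * P ^ (r + 1) * (r + 1)
        = (K.choose (r + 1) * (r + 1)) * P ^ (r + 1) := by ring
      _ = (K.choose r * P ^ r) * ((K - r) * P) := by
        rw [Nat.choose_succ_right_eq]; ring
      _ ≤ (P.choose r * K ^ r) * ((P - r) * K) := Nat.mul_le_mul ih h
      _ = (P.choose (r + 1) * (r + 1)) * K ^ (r + 1) := by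
        rw [Nat.choose_succ_right_eq]; ring
      _ = P.choose (r + 1) * K ^ (r + 1) * (r + 1) := by ring

theorem choose_le_one_add_mul_choose_succ {q : ℕ} (hq : 1 ≤ q) (u : ℕ) :
    u.choose q ≤ 1 + q * u.choose (q + 1) := by
  obtain ⟨p, rfl⟩ := Nat.exists_eq_add_of_le' hq
  induction u with
  | zero => simp
  | succ u ih =>
    rcases Nat.lt_or_ge u (p + 1) with h | h
    · rcases Nat.lt_or_ge u p with h' | h'
      · rw [Nat.choose_eq_zero_of_lt (by omega)]; omega
      · obtain rfl : u = p := by omega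
        simp
    · have h1 : u.choose p ≤ (p + 1) * u.choose (p + 1) := by
        rw [mul_comm, Nat.choose_succ_right_eq]
        exact Nat.le_mul_of_pos_right _ (by omega)
      rw [Nat.choose_succ_succ' u p, Nat.choose_succ_succ' u (p + 1), mul_add]
      omega

end Nat

/-- The factorial moments of the number of shared keys. -/
theorem sum_hypergeometric_mul_choose {r K P : ℕ} (hr : r ≤ K) (hKP : K ≤ P) :
    ∑ u ∈ Finset.range (K + 1),
      ((K.choose u : ℝ) * ((P - K).choose (K - u) : ℝ)) / (P.choose K : ℝ) * (u.choose r : ℝ) =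
      (K.choose r : ℝ) ^ 2 / (P.choose r : ℝ) := by
  have h := Nat.sum_choose_mul_choose_mul_choose hr hKP
  have h2 := Nat.choose_mul (n := P) (k := K) (s := r) hr
  have hc : (0 : ℝ) < P.choose K := by exact_mod_cast Nat.choose_pos hKP
  have hc' : (0 : ℝ) < P.choose r := by exact_mod_cast Nat.choose_pos (hr.trans hKP)
  have hR : ∑ u ∈ Finset.range (K + 1),
      (K.choose u : ℝ) * ((P - K).choose (K - u) : ℝ) * (u.choose r : ℝ) =
      K.choose r * (P - r).choose (K - r) := by exact_mod_cast h
  have h2R : (P.choose K : ℝ) * K.choose r = P.choose r * (P - r).choose (K - r) := by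
    exact_mod_cast h2
  simp_rw [div_mul_eq_mul_div]
  rw [← Finset.sum_div, hR, div_eq_div_iff hc.ne' hc'.ne']
  linear_combination -(K.choose r : ℝ) * h2R

theorem psq_eq_sum {q K P : ℕ} (hqK : q ≤ K) (hKP : K ≤ P) :
    psq q K P = ∑ u ∈ Finset.range (K + 1),
      ((K.choose u : ℝ) * ((P - K).choose (K - u) : ℝ)) / (P.choose K : ℝ) *
        (if q ≤ u then 1 else 0) := by
  have h1 := sum_hypergeometric_mul_choose (Nat.zero_le K) hKP
  simp only [Nat.choose_zero_right, Nat.cast_one, mul_one, one_pow, div_one] at h1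
  have h2 := Finset.sum_range_add_sum_Ico (fun u =>
    ((K.choose u : ℝ) * ((P - K).choose (K - u) : ℝ)) / (P.choose K : ℝ)) (by omega : q ≤ K + 1)
  rw [← Finset.sum_range_add_sum_Ico _ (by omega : q ≤ K + 1), Finset.sum_eq_zero, zero_add, psq]
  · rw [sub_eq_iff_eq_add']
    refine (h2.trans h1).symm.trans ?_
    congr 1
    refine Finset.sum_congr rfl fun u hu => ?_
    rw [if_pos (Finset.mem_Ico.mp hu).1, mul_one]
  · intro u hu
    rw [if_neg (by simpa using hu), mul_zero]

theorem psq_le_choose_sq_div {q K P : ℕ} (hqK : q ≤ K) (hKP : K ≤ P) :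
    psq q K P ≤ (K.choose q : ℝ) ^ 2 / (P.choose q : ℝ) := by
  rw [psq_eq_sum hqK hKP, ← sum_hypergeometric_mul_choose hqK hKP]
  refine Finset.sum_le_sum fun u _ => mul_le_mul_of_nonneg_left ?_ (by positivity)
  split_ifs with h
  · exact_mod_cast Nat.choose_pos h
  · positivity

theorem choose_sq_div_sub_le_psq {q K P : ℕ} (hq : 1 ≤ q) (hqK : q + 1 ≤ K) (hKP : K ≤ P) :
    (K.choose q : ℝ) ^ 2 / (P.choose q : ℝ) -
      q * ((K.choose (q + 1) : ℝ) ^ 2 / (P.choose (q + 1) : ℝ)) ≤ psq q K P := by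
  rw [psq_eq_sum (by omega) hKP, ← sum_hypergeometric_mul_choose (by omega : q ≤ K) hKP,
    ← sum_hypergeometric_mul_choose hqK hKP, Finset.mul_sum, ← Finset.sum_sub_distrib]
  refine Finset.sum_le_sum fun u _ => ?_
  rw [mul_left_comm, ← mul_sub]
  refine mul_le_mul_of_nonneg_left ?_ (by positivity)
  split_ifs with h
  · have h1 : (u.choose q : ℝ) ≤ 1 + q * u.choose (q + 1) := by
      exact_mod_cast Nat.choose_le_one_add_mul_choose_succ hq u
    linarith
  · rw [Nat.choose_eq_zero_of_lt (by omega), Nat.choose_eq_zero_of_lt (by omega)]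
    simp

theorem choose_sq_div_choose_le {r K P : ℕ} (hrK : r ≤ K) (hKP : K ≤ P) (hK : 1 ≤ K) :
    (K.choose r : ℝ) ^ 2 / (P.choose r : ℝ) ≤
      1 / (r.factorial : ℝ) * ((K : ℝ) ^ 2 / P) ^ r := by
  have hP : (0 : ℝ) < P := by exact_mod_cast hK.trans hKP
  have hc : (0 : ℝ) < P.choose r := by exact_mod_cast Nat.choose_pos (hrK.trans hKP)
  have h1 : (K.choose r : ℝ) * P ^ r ≤ P.choose r * K ^ r := by
    exact_mod_cast Nat.choose_mul_pow_le_choose_mul_pow hKP r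
  have h2 : (K.choose r : ℝ) ≤ K ^ r / r.factorial := Nat.choose_le_pow_div r K
  have h3 : (K.choose r : ℝ) / P.choose r ≤ K ^ r / P ^ r := by
    rw [div_le_div_iff₀ hc (by positivity)]
    linarith
  calc (K.choose r : ℝ) ^ 2 / (P.choose r : ℝ)
      = K.choose r * (K.choose r / P.choose r) := by ring
    _ ≤ (K ^ r / r.factorial) * (K ^ r / P ^ r) := by gcongr
    _ = 1 / (r.factorial : ℝ) * ((K : ℝ) ^ 2 / P) ^ r := by
      rw [div_pow, ← pow_mul]; ring

theorem le_choose_sq_div_choose {r K P : ℕ} (hrK : r ≤ K) (hKP : K ≤ P) (hK : 1 ≤ K) :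
    1 / (r.factorial : ℝ) * ((K : ℝ) ^ 2 / P) ^ r * (1 - 2 * r ^ 2 / K) ≤
      (K.choose r : ℝ) ^ 2 / (P.choose r : ℝ) := by
  have hK0 : (0 : ℝ) < K := by exact_mod_cast hK
  have hP : (0 : ℝ) < P := by exact_mod_cast hK.trans hKP
  have hc : (0 : ℝ) < P.choose r := by exact_mod_cast Nat.choose_pos (hrK.trans hKP)
  have hrK' : (r : ℝ) ≤ K := by exact_mod_cast hrK
  have h1 : (P.choose r : ℝ) ≤ P ^ r / r.factorial := Nat.choose_le_pow_div r P
  have h2 : ((K : ℝ) - r) ^ r / r.factorial ≤ K.choose r := by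
    refine le_trans ?_ (Nat.pow_le_choose (α := ℝ) r K)
    have h : (K : ℝ) - r ≤ ((K + 1 - r : ℕ) : ℝ) := by
      rw [Nat.cast_sub (by omega)]; push_cast; linarith
    have h0 : 0 ≤ (K : ℝ) - r := by linarith
    gcongr
  have h3 : 1 - 2 * (r : ℝ) ^ 2 / K ≤ (1 - r / K) ^ (2 * r) := by
    have hle : (r : ℝ) / K ≤ 1 := div_le_one_of_le₀ hrK' hK0.le
    have h := one_add_mul_le_pow (a := -((r : ℝ) / K)) (by linarith) (2 * r)
    rw [← sub_eq_add_neg 1] at h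
    refine le_trans (le_of_eq ?_) h
    push_cast; ring
  have h0 : 0 ≤ (K : ℝ) - r := by linarith
  calc 1 / (r.factorial : ℝ) * ((K : ℝ) ^ 2 / P) ^ r * (1 - 2 * r ^ 2 / K)
      ≤ 1 / (r.factorial : ℝ) * ((K : ℝ) ^ 2 / P) ^ r * (1 - r / K) ^ (2 * r) := by gcongr
    _ = (((K : ℝ) - r) ^ r / r.factorial) ^ 2 / (P ^ r / r.factorial) := by
      have h : (1 : ℝ) - r / K = (K - r) / K := by field_simp
      rw [h, div_pow, div_pow, pow_mul, pow_mul, div_pow, ← pow_mul _ r 2, mul_comm r 2,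
        pow_mul]
      have hf : (r.factorial : ℝ) ≠ 0 := by positivity
      field_simp
    _ ≤ (K.choose r : ℝ) ^ 2 / (P.choose r : ℝ) := by gcongr

theorem abs_psq_div_sub_one_le {q K P : ℕ} (hq : 1 ≤ q) (hqK : q + 1 ≤ K) (hKP : K ≤ P) :
    |psq q K P / (1 / (q.factorial : ℝ) * ((K : ℝ) ^ 2 / P) ^ q) - 1| ≤
      2 * q ^ 2 / K + (K : ℝ) ^ 2 / P := by
  have hK0 : (0 : ℝ) < K := by exact_mod_cast (by omega : 0 < K)
  have hP : (0 : ℝ) < P := by exact_mod_cast (by omega : 0 < P)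
  have hup := (psq_le_choose_sq_div (by omega : q ≤ K) hKP).trans
    (choose_sq_div_choose_le (by omega) hKP (by omega))
  have hlow := choose_sq_div_sub_le_psq hq hqK hKP
  have h1 := le_choose_sq_div_choose (by omega : q ≤ K) hKP (by omega)
  have h2 := choose_sq_div_choose_le hqK hKP (by omega)
  set x : ℝ := (K : ℝ) ^ 2 / P with hx
  have hx0 : 0 < x := by positivity
  set A : ℝ := 1 / (q.factorial : ℝ) * x ^ q with hA
  have hA0 : 0 < A := by positivity
  have h3 : (q : ℝ) * (1 / ((q + 1).factorial : ℝ) * x ^ (q + 1)) ≤ A * x := by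
    have h : (q : ℝ) * (1 / ((q + 1).factorial : ℝ) * x ^ (q + 1)) =
        A * x * (q / (q + 1)) := by
      rw [Nat.factorial_succ, hA]; push_cast
      field_simp
      exact pow_succ x q
    rw [h]
    exact mul_le_of_le_one_right (by positivity)
      (div_le_one_of_le₀ (by linarith) (by positivity))
  have h4 : (q : ℝ) * ((K.choose (q + 1) : ℝ) ^ 2 / (P.choose (q + 1) : ℝ)) ≤
      q * (1 / ((q + 1).factorial : ℝ) * x ^ (q + 1)) := by gcongr
  have hr1 : psq q K P / A ≤ 1 := (div_le_one hA0).2 hup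
  have hr2 : 1 - (2 * q ^ 2 / K + x) ≤ psq q K P / A := by
    rw [le_div_iff₀ hA0]
    linarith
  have h5 : (0 : ℝ) ≤ 2 * q ^ 2 / K := by positivity
  rw [abs_le]
  constructor <;> linarith

/-- if `K_n/ln n → ∞` and `(K_n²/P_n)·ln n → 0`, then
`p_{s,q}(n) = (1/q!) (K_n²/P_n)^q (1 + ε_n)` with `ε_n ln n → 0`; equivalently,
`ln n · (p_{s,q}(n)/((1/q!)(K_n²/P_n)^q) − 1) → 0`. -/
theorem psq_asymptotics_refined
    (q : ℕ) (hq : 1 ≤ q)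
    (K P : ℕ → ℕ)
    (hK1 : ∀ n, 1 ≤ K n) (hKP : ∀ n, K n ≤ P n)
    (hKinf : Tendsto (fun (n : ℕ) => (K n : ℝ) / Real.log (n : ℝ)) atTop atTop)
    (hKsqP : Tendsto (fun (n : ℕ) => ((K n : ℝ)) ^ 2 / (P n : ℝ) * Real.log (n : ℝ))
      atTop (nhds 0)) :
    Tendsto (fun (n : ℕ) => Real.log (n : ℝ) *
        (psq q (K n) (P n) /
          ((1 / (Nat.factorial q : ℝ)) * (((K n : ℝ)) ^ 2 / (P n : ℝ)) ^ q) - 1))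
      atTop (nhds 0) := by
  have hlog : Tendsto (fun n : ℕ => Real.log (n : ℝ)) atTop atTop :=
    Real.tendsto_log_atTop.comp tendsto_natCast_atTop_atTop
  have hKtop : Tendsto (fun n => (K n : ℝ)) atTop atTop := by
    refine (hKinf.atTop_mul_atTop₀ hlog).congr' ?_
    filter_upwards [hlog.eventually_gt_atTop 0] with n hn
    exact div_mul_cancel₀ _ hn.ne'
  have hbound : Tendsto (fun n : ℕ => 2 * (q : ℝ) ^ 2 * ((K n : ℝ) / Real.log (n : ℝ))⁻¹ +
      (K n : ℝ) ^ 2 / (P n : ℝ) * Real.log (n : ℝ)) atTop (nhds 0) := by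
    simpa using (hKinf.inv_tendsto_atTop.const_mul (2 * (q : ℝ) ^ 2)).add hKsqP
  refine squeeze_zero_norm' ?_ hbound
  filter_upwards [hlog.eventually_gt_atTop 0, hKtop.eventually_ge_atTop ((q : ℝ) + 1)]
    with n hn hKn
  have hqK : q + 1 ≤ K n := by exact_mod_cast hKn
  rw [Real.norm_eq_abs, abs_mul, abs_of_pos hn]
  refine (mul_le_mul_of_nonneg_left (abs_psq_div_sub_one_le hq hqK (hKP n)) hn.le).trans
    (le_of_eq ?_)
  rw [inv_div]
  ring
end

section
/- Fix integers q ≥ 1 and m ≥ 1, and scalings K_n ≤ P_n (positive integers) and p_n ∈ (0,1] with K_n²/P_n → 0 as n → ∞. For each n, let S_1*, …, S_m* be arbitrary K_n-element subsets of a key pool of size P_n, let S be a uniformly random K_n-element subset of the pool and C_1, …, C_m independent Bernoulli(p_n) variables (independent of S); say w is linked to v_i iff |S ∩ S_i*| ≥ q and C_i = 1. Then for all sufficiently large n (uniformly over all choices of S_1*,…,S_m*): the probability that w is linked to none of v_1, …, v_m is at most exp(−m·p_{e,q}(n) + (q+2)!·C(m,2)·p_{e,q}(n)^{(q+1)/q}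 + (p_{e,q}(n)·p_n/K_n)·Σ_{1≤i<j≤m} |S_i* ∩ S_j*|), where p_{e,q}(n) = p_n·(1 − Σ_{u=0}^{q−1} [C(K_n,u)·C(P_n−K_n,K_n−u)/C(P_n,K_n)]). -/
open Finset Filter

/-- A configuration for a single node `w`: its random key ring together with
the on/off states of the `m` channels from `w` to `v_1, …, v_m`. -/
abbrev WConfig (P m : ℕ) : Type := Finset (Fin P) × (Fin m → Bool)

/-- Probability weight: the key ring of `w` is uniform over the `K`-element
subsets of the pool of size `P`; the channels are independent Bernoulli(`p`). -/
noncomputable def wweight (K P m : ℕ) (p : ℝ) (ω : WConfig P m) : ℝ :=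
  (if ω.1.card = K then ((P.choose K : ℝ))⁻¹ else 0) *
  ∏ i : Fin m, if ω.2 i then p else 1 - p

/-- Probability of an event. -/
noncomputable def wprob (K P m : ℕ) (p : ℝ) (E : Set (WConfig P m)) : ℝ :=
  ∑ ω : WConfig P m, Set.indicator E (wweight K P m p) ω

/-- `w` is linked to `v_i` iff its key ring shares at least `q` keys with
`S_i*` and the channel to `v_i` is on. -/
def Linked (q P m : ℕ) (Sstar : Fin m → Finset (Fin P)) (ω : WConfig P m)
    (i : Fin m) : Prop :=
  q ≤ (ω.1 ∩ Sstar i).card ∧ ω.2 i = true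

section Counting

variable {α : Type*} [Fintype α] [DecidableEq α]

theorem card_filter_card_inter_eq (A : Finset α) {K u : ℕ} (hu : u ≤ K) :
    #{S ∈ powersetCard K (univ : Finset α) | #(S ∩ A) = u} =
      (#A).choose u * (Fintype.card α - #A).choose (K - u) := by
  rw [← card_compl, ← card_powersetCard, ← card_powersetCard, ← card_product]
  refine card_nbij' (fun S => (S ∩ A, S \ A)) (fun X => X.1 ∪ X.2) ?_ ?_ ?_ ?_
  · intro S hS
    simp only [coe_filter, mem_powersetCard, subset_univ, true_and, Set.mem_ofPred_eq] at hS
    simp only [coe_product, Set.mem_prod, mem_coe, mem_powersetCard, inter_subset_right, true_and]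
    refine ⟨hS.2, ?_, ?_⟩
    · intro x hx
      simpa using (mem_sdiff.1 hx).2
    · have := card_sdiff_add_card_inter S A
      omega
  · rintro ⟨X, Y⟩ hX
    simp only [coe_product, Set.mem_prod, mem_coe, mem_powersetCard] at hX
    obtain ⟨⟨hXA, hXu⟩, hYA, hYu⟩ := hX
    have hd : Disjoint Y A := disjoint_compl_left.mono_left hYA
    simp only [coe_filter, mem_powersetCard, subset_univ, true_and, Set.mem_ofPred_eq]
    constructor
    · rw [card_union_of_disjoint (hd.symm.mono_left hXA)]
      omega
    · rw [union_inter_distrib_right, disjoint_iff_inter_eq_empty.1 hd, union_empty,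
        inter_eq_left.2 hXA, hXu]
  · intro S _
    exact (union_comm _ _).trans (sdiff_union_inter S A)
  · rintro ⟨X, Y⟩ hX
    simp only [coe_product, Set.mem_prod, mem_coe, mem_powersetCard] at hX
    obtain ⟨⟨hXA, -⟩, hYA, -⟩ := hX
    have hd : Disjoint Y A := disjoint_compl_left.mono_left hYA
    simp only [Prod.mk.injEq]
    constructor
    · rw [union_inter_distrib_right, disjoint_iff_inter_eq_empty.1 hd, union_empty,
        inter_eq_left.2 hXA]
    · rw [union_sdiff_distrib, sdiff_eq_empty_iff_subset.2 hXA, empty_union,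
        sdiff_eq_self_of_disjoint hd]

theorem card_filter_superset_mul_le {R : Finset α} {K q : ℕ} (hR : #R = q + 1) :
    #{S ∈ powersetCard K (univ : Finset α) | R ⊆ S} * (Fintype.card α - q) ≤
      (Fintype.card α - q).choose (K - q) * (K - q) := by
  by_cases hK : q + 1 ≤ K
  · have hn : q + 1 ≤ Fintype.card α := hR ▸ card_le_univ R
    rw [card_filter_powersetCard_subset R univ K (subset_univ R) (hR ▸ hK), hR, card_univ]
    obtain ⟨a, ha⟩ := Nat.exists_eq_add_of_le hn
    obtain ⟨b, rfl⟩ := Nat.exists_eq_add_of_le hK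
    rw [ha, show q + 1 + a - (q + 1) = a by omega, show q + 1 + b - (q + 1) = b by omega,
      show q + 1 + a - q = a + 1 by omega, show q + 1 + b - q = b + 1 by omega, mul_comm]
    exact (Nat.add_one_mul_choose_eq a b).le
  · rw [filter_false_of_mem, card_empty, zero_mul]
    · exact Nat.zero_le _
    · intro S hS hRS
      have := card_le_card hRS
      rw [(mem_powersetCard.1 hS).2] at this
      omega

theorem card_filter_inter_inter_le (A B : Finset α) {K q M₁ : ℕ} (hqK : q ≤ K)
    (hM₁ : ∀ R : Finset α, #R = q + 1 →
      #{S ∈ powersetCard K (univ : Finset α) | R ⊆ S} ≤ M₁) :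
    #{S ∈ powersetCard K (univ : Finset α) | q ≤ #(S ∩ A) ∧ q ≤ #(S ∩ B)} ≤
      (#(A ∩ B)).choose q * (Fintype.card α - q).choose (K - q) +
        (#A).choose q * #(B \ A) * M₁ := by
  have hsub : {S ∈ powersetCard K (univ : Finset α) | q ≤ #(S ∩ A) ∧ q ≤ #(S ∩ B)} ⊆
      ((powersetCard q (A ∩ B)).biUnion
          fun Q => {S ∈ powersetCard K (univ : Finset α) | Q ⊆ S}) ∪
        (powersetCard q A ×ˢ (B \ A)).biUnion
          fun Qx => {S ∈ powersetCard K (univ : Finset α) | insert Qx.2 Qx.1 ⊆ S} := by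
    intro S hS
    obtain ⟨hSK, hSA, hSB⟩ := mem_filter.1 hS
    simp only [mem_union, mem_biUnion, mem_filter, hSK, true_and, mem_powersetCard, mem_product,
      Prod.exists]
    by_cases h : S ∩ B ⊆ A
    · obtain ⟨Q, hQ, hQq⟩ := exists_subset_card_eq hSB
      refine Or.inl ⟨Q, ⟨subset_inter (hQ.trans h) (hQ.trans inter_subset_right), hQq⟩,
        hQ.trans inter_subset_left⟩
    · obtain ⟨x, hx, hxA⟩ := not_subset.1 h
      obtain ⟨Q, hQ, hQq⟩ := exists_subset_card_eq hSA
      refine Or.inr ⟨Q, x, ⟨⟨hQ.trans inter_subset_right, hQq⟩,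
        mem_sdiff.2 ⟨(mem_inter.1 hx).2, hxA⟩⟩,
        insert_subset (mem_inter.1 hx).1 (hQ.trans inter_subset_left)⟩
  refine (card_le_card hsub).trans ((card_union_le _ _).trans (Nat.add_le_add ?_ ?_))
  · rw [← card_powersetCard]
    refine card_biUnion_le_card_mul _ _ _ fun Q hQ => ?_
    have hQq := (mem_powersetCard.1 hQ).2
    rw [card_filter_powersetCard_subset Q univ K (subset_univ Q) (hQq ▸ hqK), hQq, card_univ]
  · rw [← card_powersetCard, ← card_product]
    refine card_biUnion_le_card_mul _ _ _ fun Qx hQx => hM₁ _ ?_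
    obtain ⟨hQ, hx⟩ := mem_product.1 hQx
    obtain ⟨hQA, hQq⟩ := mem_powersetCard.1 hQ
    rw [card_insert_of_notMem fun h => (mem_sdiff.1 hx).2 (hQA h), hQq]

end Counting

theorem choose_add_le_choose_add_mul (n d k : ℕ) :
    (n + d).choose (k + 1) ≤ n.choose (k + 1) + d * (n + d - 1).choose k := by
  induction d with
  | zero => simp
  | succ d ih =>
    rw [← add_assoc, Nat.choose_succ_succ', Nat.add_sub_cancel, Nat.add_mul, one_mul]
    have h := Nat.mul_le_mul_left d (Nat.choose_le_choose k (Nat.sub_le (n + d) 1))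
    omega

theorem choose_sub_choose_mul_le {P K q : ℕ} (hqK : q ≤ K) (hKP : K ≤ P) :
    (P - q).choose (K - q) * (P - q) ≤
      (P - K).choose (K - q) * (P - q) + (K - q) * ((P - q).choose (K - q) * (K - q)) := by
  obtain ⟨d, rfl⟩ := Nat.exists_eq_add_of_le hqK
  obtain ⟨n, rfl⟩ := Nat.exists_eq_add_of_le hKP
  rw [show q + d + n - q = n + d by omega, show q + d - q = d by omega,
    show q + d + n - (q + d) = n by omega]
  rcases d with _ | d
  · simp
  · have h₁ := Nat.mul_le_mul_right (n + (d + 1)) (choose_add_le_choose_add_mul n (d + 1) d)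
    have h₂ := Nat.add_one_mul_choose_eq (n + d) d
    rw [show n + (d + 1) - 1 = n + d by omega] at h₁
    rw [← add_assoc] at *
    rw [← h₂]
    linarith [h₁]

theorem choose_mul_le_mul_choose {t K q : ℕ} (hq : 1 ≤ q) (htK : t ≤ K) :
    t.choose q * K ≤ t * K.choose q := by
  obtain ⟨r, rfl⟩ := Nat.exists_eq_add_of_le' hq
  rcases t with _ | t
  · simp
  · obtain ⟨k, rfl⟩ := Nat.exists_eq_add_of_le' (show 1 ≤ K by omega)
    have h₁ := Nat.add_one_mul_choose_eq t r
    have h₂ := Nat.add_one_mul_choose_eq k r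
    have h₃ := Nat.mul_le_mul_left ((t + 1) * (k + 1)) (Nat.choose_le_choose r
      (show t ≤ k by omega))
    refine Nat.le_of_mul_le_mul_right ?_ (Nat.succ_pos r)
    calc (t + 1).choose (r + 1) * (k + 1) * (r + 1)
        = (t + 1) * (k + 1) * t.choose r := by rw [mul_right_comm, ← h₁]; ring
      _ ≤ (t + 1) * (k + 1) * k.choose r := h₃
      _ = (t + 1) * (k + 1).choose (r + 1) * (r + 1) := by rw [mul_assoc, h₂]; ring

theorem psq_eq_card_div {q K P : ℕ} (hKP : K ≤ P) {A : Finset (Fin P)} (hA : #A = K) :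
    psq q K P =
      (#{S ∈ powersetCard K (univ : Finset (Fin P)) | q ≤ #(S ∩ A)} : ℝ) / P.choose K := by
  have hpos : (0 : ℝ) < P.choose K := by exact_mod_cast Nat.choose_pos hKP
  have hlow : #{S ∈ powersetCard K (univ : Finset (Fin P)) | ¬ q ≤ #(S ∩ A)} =
      ∑ u ∈ range q, K.choose u * (P - K).choose (K - u) := by
    rw [card_eq_sum_card_fiberwise (f := fun S => #(S ∩ A)) (t := range q)]
    · refine sum_congr rfl fun u hu => ?_
      have huq := mem_range.1 hu
      rw [filter_filter, filter_congr (q := fun S => #(S ∩ A) = u) fun S _ => by omega]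
      by_cases huK : u ≤ K
      · rw [card_filter_card_inter_eq A huK, hA, Fintype.card_fin]
      · rw [Nat.choose_eq_zero_of_lt (not_le.1 huK), zero_mul, card_eq_zero,
          filter_eq_empty_iff]
        intro S _ h
        have := card_le_card (inter_subset_right : S ∩ A ⊆ A)
        omega
    · intro S hS
      simp only [coe_filter, Set.mem_ofPred_eq] at hS
      simp only [coe_range, Set.mem_Iio]
      omega
  have htot := card_filter_add_card_filter_not (s := powersetCard K (univ : Finset (Fin P)))
    (fun S => q ≤ #(S ∩ A))
  rw [hlow, card_powersetCard, card_univ, Fintype.card_fin] at htot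
  rw [psq, ← sum_div, eq_div_iff hpos.ne', sub_mul, div_mul_cancel₀ _ hpos.ne', one_mul, ← htot]
  push_cast
  ring

theorem two_mul_pow_mul_le_factorial_pow {q : ℕ} (hq : 1 ≤ q) :
    (2 * q) ^ q * (2 * q.factorial) ≤ (q + 2).factorial ^ q := by
  calc (2 * q) ^ q * (2 * q.factorial)
      ≤ (2 * q) ^ q * (2 * q.factorial) ^ q :=
        Nat.mul_le_mul_left _ (Nat.le_self_pow (by omega) _)
    _ = (4 * q * q.factorial) ^ q := by rw [← mul_pow]; ring
    _ ≤ (q + 2).factorial ^ q := by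
        refine Nat.pow_le_pow_left ?_ q
        rw [Nat.factorial_succ, Nat.factorial_succ, ← mul_assoc]
        exact Nat.mul_le_mul_right _ (by nlinarith [Nat.mul_le_mul hq hq])

theorem mul_le_factorial_mul_rpow {q : ℕ} (hq : 1 ≤ q) {s D x y : ℝ} (hx : 0 ≤ x) (hy : 0 ≤ y)
    (hDs : D ≤ 2 * s) (hxD : x ^ q / q.factorial ≤ D) (hyx : y ≤ q * x) :
    D * y ≤ (q + 2).factorial * s ^ (((q : ℝ) + 1) / q) := by
  have hq0 : (0 : ℝ) < q := by exact_mod_cast hq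
  have hf : (0 : ℝ) < q.factorial := by exact_mod_cast q.factorial_pos
  have hs : 0 ≤ s := by
    have : 0 ≤ x ^ q / q.factorial := by positivity
    linarith
  have hr0 : 0 ≤ s ^ (1 / (q : ℝ)) := Real.rpow_nonneg hs _
  have hrq : (s ^ (1 / (q : ℝ))) ^ q = s := by
    rw [one_div, Real.rpow_inv_natCast_pow hs (by omega)]
  have hexp : s ^ (((q : ℝ) + 1) / q) = s * s ^ (1 / (q : ℝ)) := by
    rw [add_div, div_self hq0.ne', Real.rpow_add_of_nonneg hs zero_le_one (by positivity),
      Real.rpow_one]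
  have hfac : ((2 * q : ℝ)) ^ q * (2 * q.factorial) ≤ ((q + 2).factorial : ℝ) ^ q := by
    exact_mod_cast two_mul_pow_mul_le_factorial_pow hq
  have hxs : x ^ q ≤ 2 * q.factorial * s := by
    have := (div_le_iff₀ hf).1 (hxD.trans hDs)
    linarith
  have h2y : 2 * y ≤ (q + 2).factorial * s ^ (1 / (q : ℝ)) := by
    refine le_of_pow_le_pow_left₀ (n := q) (by omega) (by positivity) ?_
    calc (2 * y) ^ q ≤ (2 * q * x) ^ q := pow_le_pow_left₀ (by positivity) (by linarith) q
      _ = (2 * q) ^ q * x ^ q := mul_pow _ _ _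
      _ ≤ (2 * q) ^ q * (2 * q.factorial * s) := by gcongr
      _ = (2 * q) ^ q * (2 * q.factorial) * s := by ring
      _ ≤ ((q + 2).factorial : ℝ) ^ q * s := by gcongr
      _ = ((q + 2).factorial * s ^ (1 / (q : ℝ))) ^ q := by rw [mul_pow, hrq]
  rw [hexp]
  calc D * y ≤ 2 * s * y := by gcongr
    _ = s * (2 * y) := by ring
    _ ≤ s * ((q + 2).factorial * s ^ (1 / (q : ℝ))) := by gcongr
    _ = _ := by ring

theorem pow_div_factorial_le_choose_mul_div {q K P : ℕ} (hqK : q ≤ K) (hKP : K ≤ P) :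
    (((K : ℝ) - q + 1) ^ 2 / P) ^ q / q.factorial ≤
      K.choose q * (P - q).choose (K - q) / P.choose K := by
  have hN : (0 : ℝ) < P.choose K := by exact_mod_cast Nat.choose_pos hKP
  have hPq : (0 : ℝ) < P.choose q := by exact_mod_cast Nat.choose_pos (hqK.trans hKP)
  have hf : (0 : ℝ) < q.factorial := by exact_mod_cast q.factorial_pos
  have hmul : (P.choose K : ℝ) * K.choose q = P.choose q * (P - q).choose (K - q) := by
    exact_mod_cast Nat.choose_mul (n := P) hqK
  have hup : (P.choose q : ℝ) ≤ (P : ℝ) ^ q / q.factorial := Nat.choose_le_pow_div q P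
  have hlo : ((K : ℝ) - q + 1) ^ q / q.factorial ≤ K.choose q := by
    have h := Nat.pow_le_choose (α := ℝ) q K
    have hc : ((K + 1 - q : ℕ) : ℝ) = (K : ℝ) - q + 1 := by
      rw [Nat.cast_sub (by omega)]; push_cast; ring
    rwa [hc] at h
  have hKq : (0 : ℝ) ≤ (K : ℝ) - q + 1 := by
    have : (q : ℝ) ≤ K := by exact_mod_cast hqK
    linarith
  have hPpow : (0 : ℝ) < (P : ℝ) ^ q := by
    have := hPq.trans_le hup
    exact (div_pos_iff_of_pos_right hf).1 this
  calc (((K : ℝ) - q + 1) ^ 2 / P) ^ q / q.factorial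
      = (((K : ℝ) - q + 1) ^ q / q.factorial) ^ 2 / ((P : ℝ) ^ q / q.factorial) := by
        rw [div_pow, div_pow, ← pow_mul, ← pow_mul, mul_comm 2 q]
        field_simp
    _ ≤ (K.choose q : ℝ) ^ 2 / P.choose q := by gcongr
    _ = K.choose q * (P - q).choose (K - q) / P.choose K := by
        rw [div_eq_div_iff hPq.ne' hN.ne']
        linear_combination (K.choose q : ℝ) * hmul

theorem sub_div_sub_mul_le {q K P : ℕ} (hq : 1 ≤ q) (hqK : q ≤ K) (hP : 2 * K ^ 2 ≤ P) :
    ((K : ℝ) - q) / (P - q) * K ≤ 1 / 2 ∧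
      ((K : ℝ) - q) / (P - q) * K ≤ q * (((K : ℝ) - q + 1) ^ 2 / P) := by
  have hq1 : (1 : ℝ) ≤ q := by exact_mod_cast hq
  have hK : (q : ℝ) ≤ K := by exact_mod_cast hqK
  have hP2 : 2 * (K : ℝ) ^ 2 ≤ P := by exact_mod_cast hP
  have hPK : 2 * (K : ℝ) ≤ P := by nlinarith
  have hPpos : (0 : ℝ) < P := by linarith
  have hPq : (0 : ℝ) < P - q := by linarith
  constructor
  · rw [div_mul_eq_mul_div, div_le_iff₀ hPq]
    nlinarith
  · have h₁ : ((K : ℝ) - q) / (P - q) ≤ (K - q + 1) / P := by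
      rw [div_le_div_iff₀ hPq hPpos]
      nlinarith
    have h₂ : (K : ℝ) ≤ q * (K - q + 1) := by nlinarith
    calc ((K : ℝ) - q) / (P - q) * K ≤ (K - q + 1) / P * (q * (K - q + 1)) := by
          refine mul_le_mul h₁ h₂ (by linarith) (div_nonneg (by linarith) hPpos.le)
      _ = _ := by ring

theorem card_div_choose_le {q K P : ℕ} (hq : 1 ≤ q) (hK : 1 ≤ K) (hP : 2 * K ^ 2 ≤ P)
    {A B : Finset (Fin P)} (hA : #A = K) (hB : #B = K) :
    (#{S ∈ powersetCard K (univ : Finset (Fin P)) | q ≤ #(S ∩ A) ∧ q ≤ #(S ∩ B)} : ℝ) /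
        P.choose K ≤
      (q + 2).factorial * psq q K P ^ (((q : ℝ) + 1) / q) + psq q K P / K * #(A ∩ B) := by
  have hKP : K ≤ P := by nlinarith
  have hs := psq_eq_card_div (q := q) hKP hA
  have hs0 : 0 ≤ psq q K P := by rw [hs]; positivity
  rcases lt_or_ge K q with hKq | hqK
  · rw [filter_false_of_mem, card_empty, Nat.cast_zero, zero_div]
    · positivity
    · rintro S - ⟨h, -⟩
      have := card_le_card (inter_subset_right : S ∩ A ⊆ A)
      omega
  have hN : (0 : ℝ) < P.choose K := by exact_mod_cast Nat.choose_pos hKP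
  have hqP : q < P := by nlinarith
  have hK0 : (0 : ℝ) < K := by exact_mod_cast hK
  have hKqR : (q : ℝ) ≤ K := by exact_mod_cast hqK
  have hPq : (0 : ℝ) < P - q := by
    have : (q : ℝ) < P := by exact_mod_cast hqP
    linarith
  obtain ⟨he_half, he_le⟩ := sub_div_sub_mul_le hq hqK hP
  set M : ℕ := (P - q).choose (K - q) with hM
  set e : ℝ := ((K : ℝ) - q) / (P - q) with he
  set D : ℝ := K.choose q * M / P.choose K with hD
  set t : ℕ := #(A ∩ B) with ht
  have he0 : 0 ≤ e := div_nonneg (by linarith) hPq.le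
  have hD0 : 0 ≤ D := by positivity
  have htK : t ≤ K := hA ▸ card_le_card inter_subset_left
  have htKR : (t : ℝ) ≤ K := by exact_mod_cast htK
  have hdiff : #(B \ A) = K - t := by rw [card_sdiff, hB, ht]
  have hM₁ : ((M * (K - q) / (P - q) : ℕ) : ℝ) ≤ M * e := by
    refine Nat.cast_div_le.trans_eq ?_
    rw [Nat.cast_mul, Nat.cast_sub hqK, Nat.cast_sub hqP.le, he, mul_div_assoc]
  have hjoint : (#{S ∈ powersetCard K (univ : Finset (Fin P)) |
      q ≤ #(S ∩ A) ∧ q ≤ #(S ∩ B)} : ℝ) / P.choose K ≤ t / K * D + D * (K - t) * e := by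
    have hcount := card_filter_inter_inter_le A B (M₁ := M * (K - q) / (P - q)) hqK
      fun R hR => (Nat.le_div_iff_mul_le (by omega)).2 <| by
        simpa using card_filter_superset_mul_le (K := K) hR
    rw [Fintype.card_fin, hdiff, hA, ← hM, ← ht] at hcount
    have hcountR := (Nat.cast_le (α := ℝ)).2 hcount
    push_cast [Nat.cast_sub htK] at hcountR
    have hchoose : (t.choose q : ℝ) ≤ t / K * K.choose q := by
      rw [div_mul_eq_mul_div, le_div_iff₀ hK0]
      exact_mod_cast choose_mul_le_mul_choose hq htK
    have hKt : (0 : ℝ) ≤ K - t := by linarith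
    rw [div_le_iff₀ hN]
    calc _ ≤ _ := hcountR
      _ ≤ t / K * K.choose q * M + K.choose q * (K - t) * (M * e) := by
        gcongr
      _ = (t / K * D + D * (K - t) * e) * P.choose K := by
        rw [hD]
        field_simp
  have hlower : D * (1 - (K - q) * e) ≤ psq q K P := by
    have hle : K.choose q * (P - K).choose (K - q) ≤
        #{S ∈ powersetCard K (univ : Finset (Fin P)) | q ≤ #(S ∩ A)} := by
      have h := card_filter_card_inter_eq A hqK
      rw [hA, Fintype.card_fin] at h
      rw [← h]
      exact card_le_card (monotone_filter_right _ fun S _ hS => hS.ge)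
    have hdrop : (M : ℝ) * (1 - (K - q) * e) ≤ (P - K).choose (K - q) := by
      have h := (Nat.cast_le (α := ℝ)).2 (choose_sub_choose_mul_le hqK hKP)
      rw [← hM] at h
      push_cast [Nat.cast_sub hqK, Nat.cast_sub hqP.le] at h
      refine le_of_mul_le_mul_right ?_ hPq
      have hee : e * (P - q) = K - q := div_mul_cancel₀ _ hPq.ne'
      linear_combination h - M * (K - q) * hee
    rw [hs, le_div_iff₀ hN]
    calc D * (1 - (K - q) * e) * P.choose K = K.choose q * (M * (1 - (K - q) * e)) := by
          rw [hD]
          field_simp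
      _ ≤ K.choose q * (P - K).choose (K - q) := by gcongr
      _ ≤ _ := by exact_mod_cast hle
  have hKqe : (K - q) * e ≤ 1 / 2 := by nlinarith
  have hD2 : D ≤ 2 * psq q K P := by nlinarith
  have hmain := mul_le_factorial_mul_rpow hq (y := e * K) (by positivity) (by positivity) hD2
    (pow_div_factorial_le_choose_mul_div hqK hKP) he_le
  have hshared : t / K * (D * (1 - (K - q) * e)) ≤ psq q K P / K * t := by
    rw [div_mul_comm]
    gcongr
  have hrest : t / K * (D * ((K - q) * e)) ≤ t * (D * e) := by
    have : t / K * (D * ((K - q) * e)) = t * (D * e) * ((K - q) / K) := by ring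
    rw [this]
    refine mul_le_of_le_one_right (by positivity) ((div_le_one hK0).2 ?_)
    linarith [(Nat.cast_nonneg q : (0 : ℝ) ≤ q)]
  linarith

theorem prod_one_sub_le {ι : Type*} [Fintype ι] [LinearOrder ι] {x : ι → ℝ}
    (h0 : ∀ i, 0 ≤ x i) (h1 : ∀ i, x i ≤ 1) :
    ∏ i, (1 - x i) ≤ 1 - ∑ i, x i +
      ∑ pr ∈ (univ : Finset (ι × ι)).filter (fun pr => pr.1 < pr.2), x pr.1 * x pr.2 := by
  have hweier : ∀ s : Finset ι, 1 - ∑ j ∈ s, x j ≤ ∏ j ∈ s, (1 - x j) := fun s => by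
    induction s using Finset.induction_on with
    | empty => simp
    | insert a s ha ih =>
      rw [prod_insert ha, sum_insert ha]
      have := prod_le_one (s := s) (fun j _ => sub_nonneg.2 (h1 j)) fun j _ => by
        linarith [h0 j]
      nlinarith [h0 a]
  have hpairs : ∑ pr ∈ (univ : Finset (ι × ι)).filter (fun pr => pr.1 < pr.2), x pr.1 * x pr.2 =
      ∑ i, x i * ∑ j with j < i, x j := by
    rw [sum_filter, Fintype.sum_prod_type_right]
    refine sum_congr rfl fun i _ => ?_
    rw [mul_sum, sum_filter]
    exact sum_congr rfl fun j _ => by simp only [mul_comm]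
  rw [prod_one_sub_ordered, hpairs]
  have : ∑ i, x i * (1 - ∑ j with j < i, x j) ≤ ∑ i, x i * ∏ j with j < i, (1 - x j) :=
    sum_le_sum fun i _ => mul_le_mul_of_nonneg_left (hweier _) (h0 i)
  simp only [mul_sub, mul_one, sum_sub_distrib] at this
  linarith

theorem card_filter_fst_lt_snd (m : ℕ) :
    #((univ : Finset (Fin m × Fin m)).filter fun pr => pr.1 < pr.2) = m.choose 2 := by
  rw [card_filter, Fintype.sum_prod_type_right]
  simp only [← card_filter, filter_gt_eq_Iio, Fin.card_Iio]
  rw [Fin.sum_univ_eq_sum_range (fun i => i), sum_range_id, Nat.choose_two_right]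

theorem wprob_linked_none (q K P m : ℕ) (p : ℝ) (Sstar : Fin m → Finset (Fin P)) :
    wprob K P m p {ω | ∀ i : Fin m, ¬ Linked q P m Sstar ω i} =
      (∑ S ∈ powersetCard K (univ : Finset (Fin P)),
        ∏ i, (1 - if q ≤ #(S ∩ Sstar i) then p else 0)) / P.choose K := by
  classical
  have hring : ∀ S : Finset (Fin P),
      ∑ c : Fin m → Bool, Set.indicator {ω | ∀ i : Fin m, ¬ Linked q P m Sstar ω i}
        (wweight K P m p) (S, c) =
      (if #S = K then (P.choose K : ℝ)⁻¹ else 0) *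
        ∏ i, (1 - if q ≤ #(S ∩ Sstar i) then p else 0) := fun S => by
    have hfactor : ∀ i, (1 - if q ≤ #(S ∩ Sstar i) then p else 0) =
        ∑ b : Bool, if q ≤ #(S ∩ Sstar i) ∧ b = true then 0 else if b then p else 1 - p :=
      fun i => by
        rw [Fintype.sum_bool]
        by_cases h : q ≤ #(S ∩ Sstar i) <;> simp [h]
    simp only [hfactor]
    rw [Fintype.prod_sum, mul_sum]
    refine sum_congr rfl fun c _ => ?_
    by_cases hc : ∀ i, ¬ (q ≤ #(S ∩ Sstar i) ∧ c i = true)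
    · rw [Set.indicator_of_mem (by exact hc), wweight]
      congr 1
      exact prod_congr rfl fun i _ => by rw [if_neg (hc i)]
    · rw [Set.indicator_of_notMem (by exact hc)]
      push Not at hc
      obtain ⟨i, hi⟩ := hc
      symm
      exact mul_eq_zero_of_right _ (prod_eq_zero (mem_univ i) (if_pos hi))
  rw [wprob, Fintype.sum_prod_type, sum_congr rfl fun S _ => hring S, sum_div]
  simp only [ite_mul, zero_mul]
  rw [← sum_filter, ← powerset_univ, ← powersetCard_eq_filter]
  exact sum_congr rfl fun S _ => by rw [div_eq_inv_mul]

theorem wprob_linked_none_le {q K P m : ℕ} (hKP : K ≤ P) {p : ℝ} (hp : p ∈ Set.Ioc (0 : ℝ) 1)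
    {Sstar : Fin m → Finset (Fin P)} (hS : ∀ i, #(Sstar i) = K) :
    wprob K P m p {ω | ∀ i : Fin m, ¬ Linked q P m Sstar ω i} ≤
      1 - m * peq q K P p +
        ∑ pr ∈ (univ : Finset (Fin m × Fin m)).filter (fun pr => pr.1 < pr.2),
          p ^ 2 * ((#{S ∈ powersetCard K (univ : Finset (Fin P)) |
            q ≤ #(S ∩ Sstar pr.1) ∧ q ≤ #(S ∩ Sstar pr.2)} : ℝ) / P.choose K) := by
  have hN : (0 : ℝ) < P.choose K := by exact_mod_cast Nat.choose_pos hKP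
  rw [wprob_linked_none, div_le_iff₀ hN]
  refine (sum_le_sum fun S _ => prod_one_sub_le (fun i => ?_) fun i => ?_).trans_eq ?_
  · split_ifs
    exacts [hp.1.le, le_rfl]
  · split_ifs
    exacts [hp.2, zero_le_one]
  · rw [sum_add_distrib, sum_sub_distrib, add_mul, sub_mul, sum_mul, sum_comm,
      sum_comm (s := powersetCard K univ)]
    congr 1
    · congr 1
      · simp
      · have hterm : ∀ i, ∑ S ∈ powersetCard K (univ : Finset (Fin P)),
            (if q ≤ #(S ∩ Sstar i) then p else 0) = peq q K P p * P.choose K := fun i => by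
          rw [← sum_filter, sum_const, nsmul_eq_mul, peq, psq_eq_card_div hKP (hS i), mul_assoc,
            div_mul_cancel₀ _ hN.ne', mul_comm]
        rw [sum_congr rfl fun i _ => hterm i, sum_const, card_univ, Fintype.card_fin,
          nsmul_eq_mul, mul_assoc]
    · refine sum_congr rfl fun pr _ => ?_
      rw [mul_assoc, div_mul_cancel₀ _ hN.ne', mul_comm, ← nsmul_eq_mul, ← sum_const, sum_filter]
      refine sum_congr rfl fun S _ => ?_
      by_cases h₁ : q ≤ #(S ∩ Sstar pr.1) <;> by_cases h₂ : q ≤ #(S ∩ Sstar pr.2) <;>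
        simp [h₁, h₂, sq]

/-- with `K_n²/P_n → 0`, for all sufficiently large `n`,
uniformly over all choices of `K_n`-subsets `S_1*, …, S_m*`,
`P[w is linked to none of v_1, …, v_m] ≤
  exp(−m p_{e,q} + (q+2)!·C(m,2)·p_{e,q}^{(q+1)/q}
      + (p_{e,q} p_n/K_n)·Σ_{1≤i<j≤m} |S_i* ∩ S_j*|)`. -/
theorem linked_none_prob_upper_bound
    (q m : ℕ) (hq : 1 ≤ q) (hm : 1 ≤ m)
    (K P : ℕ → ℕ) (p : ℕ → ℝ)
    (hK1 : ∀ n, 1 ≤ K n) (hKP : ∀ n, K n ≤ P n)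
    (hp : ∀ n, p n ∈ Set.Ioc (0 : ℝ) 1)
    (hKsqP : Tendsto (fun n => ((K n : ℝ)) ^ 2 / (P n : ℝ)) atTop (nhds 0)) :
    ∀ᶠ (n : ℕ) in atTop,
      ∀ Sstar : Fin m → Finset (Fin (P n)), (∀ i, (Sstar i).card = K n) →
        wprob (K n) (P n) m (p n) {ω | ∀ i : Fin m, ¬ Linked q (P n) m Sstar ω i}
          ≤ Real.exp (-(m : ℝ) * peq q (K n) (P n) (p n)
              + (Nat.factorial (q + 2) : ℝ) * (m.choose 2 : ℝ) *
                  peq q (K n) (P n) (p n) ^ (((q : ℝ) + 1) / (q : ℝ))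
              + peq q (K n) (P n) (p n) * p n / (K n : ℝ) *
                  ∑ pr ∈ Finset.univ.filter (fun pr : Fin m × Fin m => pr.1 < pr.2),
                    ((Sstar pr.1 ∩ Sstar pr.2).card : ℝ)) := by
  have hev := (hKsqP.eventually (ge_mem_nhds (show (0 : ℝ) < 1 / 2 by norm_num)))
  filter_upwards [hev] with n hn Sstar hS
  have hP0 : (0 : ℝ) < P n := by exact_mod_cast (hK1 n).trans (hKP n)
  have hP : 2 * K n ^ 2 ≤ P n := by
    rw [div_le_iff₀ hP0] at hn
    have : 2 * (K n : ℝ) ^ 2 ≤ P n := by linarith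
    exact_mod_cast this
  obtain ⟨hp0, hp1⟩ := hp n
  have hq0 : (0 : ℝ) < q := by exact_mod_cast hq
  have hpair : ∀ i j : Fin m,
      p n ^ 2 * ((#{S ∈ powersetCard (K n) (univ : Finset (Fin (P n))) |
          q ≤ #(S ∩ Sstar i) ∧ q ≤ #(S ∩ Sstar j)} : ℝ) / (P n).choose (K n)) ≤
        (q + 2).factorial * peq q (K n) (P n) (p n) ^ (((q : ℝ) + 1) / q) +
          peq q (K n) (P n) (p n) * p n / K n * #(Sstar i ∩ Sstar j) := fun i j => by
    have hs0 : 0 ≤ psq q (K n) (P n) := by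
      rw [psq_eq_card_div (hKP n) (hS i)]
      positivity
    have hpow : p n ^ 2 ≤ p n ^ (((q : ℝ) + 1) / q) := by
      rw [← Real.rpow_natCast]
      refine Real.rpow_le_rpow_of_exponent_ge hp0 hp1 ?_
      rw [div_le_iff₀ hq0]
      have : (1 : ℝ) ≤ q := by exact_mod_cast hq
      push_cast
      linarith
    calc _ ≤ p n ^ 2 * ((q + 2).factorial * psq q (K n) (P n) ^ (((q : ℝ) + 1) / q) +
          psq q (K n) (P n) / K n * #(Sstar i ∩ Sstar j)) := by
          gcongr
          exact card_div_choose_le hq (hK1 n) hP (hS i) (hS j)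
      _ = (q + 2).factorial * (p n ^ 2 * psq q (K n) (P n) ^ (((q : ℝ) + 1) / q)) +
          peq q (K n) (P n) (p n) * p n / K n * #(Sstar i ∩ Sstar j) := by
          rw [peq]
          ring
      _ ≤ _ := by
          rw [peq, Real.mul_rpow hp0.le hs0]
          gcongr
  refine (wprob_linked_none_le (hKP n) (hp n) hS).trans (le_trans ?_ (Real.add_one_le_exp _))
  have hsum := sum_le_sum
    fun pr (_ : pr ∈ (univ : Finset (Fin m × Fin m)).filter fun pr => pr.1 < pr.2) =>
      hpair pr.1 pr.2
  rw [sum_add_distrib, sum_const, card_filter_fst_lt_snd, nsmul_eq_mul] at hsum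
  rw [mul_sum]
  linarith
end
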